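/- arXiv:1901.02632 — 5 statements merged into one kernel-verified Lean document; each statement's English description precedes it below -/
import Mathlib

section
/- Let K be a field and let v_1, …, v_n be nontrivial localities on K which are pairwise independent. Let x_1, …, x_n ∈ K and z_1, …, z_n ∈ K^×. Then there exists x ∈ K with x − x_i ∈ z_i·m_{v_i} for i = 1, …, n. -/
namespace PaperApprox

variable {K : Type*} [Field K]

/-- The "maximal ideal" `m_O = O \ O^×` of a ball `O`, where `O^× = O ∩ O⁻¹` and
`O⁻¹ = {x⁻¹ : 0 ≠ x ∈ O} = {x | x ≠ 0 ∧ x⁻¹ ∈ O}`. -/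
def mball (O : Set K) : Set K := O \ (O ∩ {x | x ≠ 0 ∧ x⁻¹ ∈ O})

/-- The scaled set `z·S`. -/
def scale (z : K) (S : Set K) : Set K := {y | ∃ s ∈ S, y = z * s}

/-- A positive cone of a field ordering. -/
def IsOrderingCone (P : Set K) : Prop :=
  (∀ a ∈ P, ∀ b ∈ P, a + b ∈ P) ∧ (∀ a ∈ P, ∀ b ∈ P, a * b ∈ P) ∧
    (∀ x : K, x ∈ P ∨ -x ∈ P) ∧ ∀ x : K, x ∈ P → -x ∈ P → x = 0

/-- `x ≤_P y` for a positive cone `P`. -/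
def coneLE (P : Set K) (a b : K) : Prop := b - a ∈ P

/-- `x <_P y` for a positive cone `P`. -/
def coneLT (P : Set K) (a b : K) : Prop := b - a ∈ P ∧ a ≠ b

/-- The unit interval `{x : -1 ≤_P x ≤_P 1}` of an ordering. -/
def orderingBall (P : Set K) : Set K := {x | x + 1 ∈ P ∧ 1 - x ∈ P}

/-- `O` is the valuation ring of a (Krull) valuation on `K`. -/
def IsValuationLocality (O : Set K) : Prop := ∃ A : ValuationSubring K, O = (A : Set K)

/-- `O` is the unit interval of a field ordering of `K`. -/
def IsOrderingLocality (O : Set K) : Prop := ∃ P : Set K, IsOrderingCone P ∧ O = orderingBall P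

/-- `O` is the closed unit ball of an absolute value on `K`. -/
def IsAbsLocality (O : Set K) : Prop := ∃ f : AbsoluteValue K ℝ, O = {x | f x ≤ 1}

/-- A locality on `K`, identified with its ring/ball `O`. -/
def IsLocality (O : Set K) : Prop := IsValuationLocality O ∨ IsOrderingLocality O ∨ IsAbsLocality O

/-- `W` is the finest common coarsening of the localities `O₁`, `O₂`. -/
def IsFCC (O₁ O₂ W : Set K) : Prop :=
  IsLocality W ∧ O₁ ⊆ W ∧ O₂ ⊆ W ∧ ∀ W', IsLocality W' → O₁ ⊆ W' → O₂ ⊆ W' → W ⊆ W'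

/-- Two subsets `A`, `B` of `W` have the same image in the residue field `W/m_W`. -/
def SameResidue (W A B : Set K) : Prop :=
  (∀ x ∈ A, ∃ y ∈ B, x - y ∈ mball W) ∧ ∀ y ∈ B, ∃ x ∈ A, x - y ∈ mball W

/-- Incomparability of localities. -/
def Incomp (O₁ O₂ : Set K) : Prop := ¬O₁ ⊆ O₂ ∧ ¬O₂ ⊆ O₁

/-- Strong incomparability: incomparable, and the induced localities on the residue field of
the finest common coarsening are distinct (their rings, i.e. the images of `O₁` and `O₂`,
differ). -/
def StronglyIncomp (O₁ O₂ : Set K) : Prop :=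
  Incomp O₁ O₂ ∧ ∀ W, IsFCC O₁ O₂ W → ¬SameResidue W O₁ O₂

/-- `t`-independence of localities. -/
def TIndep (t : K) (O₁ O₂ : Set K) : Prop :=
  (∀ W, IsFCC O₁ O₂ W → t ∈ W ∧ t⁻¹ ∈ W) ∧
    (IsOrderingLocality O₁ → IsOrderingLocality O₂ → StronglyIncomp O₁ O₂)

/-- `t`-independence of valuation rings: `t` and `t⁻¹` lie in the smallest valuation ring
containing both. -/
def TIndepVal (t : K) (O₁ O₂ : Set K) : Prop :=
  ∀ W : Set K, IsValuationLocality W → O₁ ⊆ W → O₂ ⊆ W →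
    (∀ W', IsValuationLocality W' → O₁ ⊆ W' → O₂ ⊆ W' → W ⊆ W') → t ∈ W ∧ t⁻¹ ∈ W

/-- `t`-independence of sets of localities. -/
def SetTIndep (t : K) (S₁ S₂ : Set (Set K)) : Prop := ∀ v ∈ S₁, ∀ w ∈ S₂, TIndep t v w

/-- Incomparability of sets of localities. -/
def SetIncomp (S₁ S₂ : Set (Set K)) : Prop := ∀ v ∈ S₁, ∀ w ∈ S₂, Incomp v w

/-- Independence of localities: the field topologies they induce on `K` (with the sets
`z·m_v`, `z ∈ K^×`, as neighbourhood bases of `0`) are distinct. -/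
def IndepLoc (O₁ O₂ : Set K) : Prop :=
  ¬((∀ z : K, z ≠ 0 → ∃ z' : K, z' ≠ 0 ∧ scale z' (mball O₂) ⊆ scale z (mball O₁)) ∧
     ∀ z : K, z ≠ 0 → ∃ z' : K, z' ≠ 0 ∧ scale z' (mball O₁) ⊆ scale z (mball O₂))

/-- The Zariski topology on localities/balls of `K`. -/
def zarTop (K : Type*) [Field K] : TopologicalSpace (Set K) :=
  TopologicalSpace.generateFrom {U | ∃ x : K, U = {O : Set K | x ∈ O}}

/-- The Hochster dual of the Zariski topology. -/
def zarStarTop (K : Type*) [Field K] : TopologicalSpace (Set K) :=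
  TopologicalSpace.generateFrom {U | ∃ x : K, U = {O : Set K | x ∈ mball O}}

/-- The constructible topology. -/
def conTop (K : Type*) [Field K] : TopologicalSpace (Set K) :=
  TopologicalSpace.generateFrom
    ({U | ∃ x : K, U = {O : Set K | x ∈ O}} ∪ {U | ∃ x : K, U = {O : Set K | x ∈ mball O}})

/-- The Harrison topology on orderings (positive cones) of `K`. -/
def harrisonTop (K : Type*) [Field K] : TopologicalSpace (Set K) :=
  TopologicalSpace.generateFrom {U | ∃ x : K, x ≠ 0 ∧ U = {P : Set K | x ∈ P}}

/-- Condition (i): `f(O) ⊆ O`. -/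
def CondI (f : Polynomial K) (O : Set K) : Prop := ∀ x ∈ O, f.eval x ∈ O

/-- Condition (ii): `f(x) ∉ t·m_O` for `x ∈ O`. -/
def CondII (t : K) (f : Polynomial K) (O : Set K) : Prop := ∀ x ∈ O, f.eval x ∉ scale t (mball O)

/-- Condition (iii): `f(x) ∈ x^d (O \ t·m_O) ∩ (a_d x^d + x^(d-1) O)` for `x ∉ O`. -/
def CondIII (t : K) (f : Polynomial K) (O : Set K) : Prop :=
  ∀ x : K, x ∉ O →
    f.eval x ∈ scale (x ^ f.natDegree) (O \ scale t (mball O)) ∧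
      ∃ u ∈ O, f.eval x = f.leadingCoeff * x ^ f.natDegree + x ^ (f.natDegree - 1) * u

/-- Condition (iv): `O + O ⊆ t⁻¹·O`. -/
def CondIV (t : K) (O : Set K) : Prop := ∀ a ∈ O, ∀ b ∈ O, a + b ∈ scale t⁻¹ O

/-- Assumption (U) for a set `S` of localities and `t ∈ K^×`. -/
def AssumptionU (S : Set (Set K)) (t : K) : Prop :=
  ∃ f : Polynomial K, 2 ≤ f.natDegree ∧
    ∀ v ∈ S, CondI f v ∧ CondII t f v ∧ CondIII t f v ∧ CondIV t v

/-- Assumption (U-exc) for finitely many sets `S 1, …, S n` of localities and `t ∈ K^×`: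
conditions (i), (iii), (iv) everywhere, and condition (ii) on the infinite `S i`. -/
def AssumptionUExc {n : ℕ} (S : Fin n → Set (Set K)) (t : K) : Prop :=
  ∃ f : Polynomial K, 2 ≤ f.natDegree ∧
    (∀ i, ∀ v ∈ S i, CondI f v ∧ CondIII t f v ∧ CondIV t v) ∧
      ∀ i, (S i).Infinite → ∀ v ∈ S i, CondII t f v

/-- `S_π^e(K)`: valuation rings whose value group has a smallest positive element `γ`
(multiplicatively: a largest element `γ < 1`), such that `ℤγ` is convex and
`0 < v(π) ≤ eγ` (multiplicatively `γ^e ≤ v(π) < 1`). -/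
def SPiE (π : K) (e : ℕ) : Set (Set K) :=
  {O | ∃ A : ValuationSubring K, O = (A : Set K) ∧
    ∃ γ : A.ValueGroup, γ ≠ 0 ∧ γ < 1 ∧
      (∀ δ : A.ValueGroup, δ ≠ 0 → δ < 1 → δ ≤ γ) ∧
      (∀ δ : A.ValueGroup, δ ≠ 0 → ∀ m n : ℤ, γ ^ m ≤ δ → δ ≤ γ ^ n → ∃ k : ℤ, δ = γ ^ k) ∧
      A.valuation π < 1 ∧ γ ^ e ≤ A.valuation π}

/-- `O_w` is convex with respect to the ordering with positive cone `P`. -/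
def ConvexWrtOrdering (P W : Set K) : Prop :=
  ∀ u w : K, u ∈ P → w - u ∈ P → w ∈ W → u ∈ W

/-- Iterated application `φ(x₁, φ(x₂, …))`. -/
def iterPhi (φ : K → K → K) : K → List K → K
  | x, [] => x
  | x, y :: l => φ x (iterPhi φ y l)

/-- Common properties of nontrivial localities. -/
structure VB (O : Set K) : Prop where
  one : (1 : K) ∈ O
  neg : ∀ a ∈ O, -a ∈ O
  mul : ∀ a ∈ O, ∀ b ∈ O, a * b ∈ O
  inv : ∀ a, a ∉ O → a⁻¹ ∈ O
  add : ∃ c : K, c ≠ 0 ∧ ∀ a ∈ O, ∀ b ∈ O, c * (a + b) ∈ O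
  nontriv : ∃ w, w ∉ O

theorem VB.zero {O : Set K} (h : VB O) : (0 : K) ∈ O := by
  by_contra h0
  exact h0 (by simpa using h.inv 0 h0)

theorem vb_val {O : Set K} (h : IsValuationLocality O) (hn : O ≠ Set.univ) : VB O := by
  obtain ⟨A, rfl⟩ := h
  refine ⟨A.one_mem, fun a ha => A.neg_mem a ha, fun a ha b hb => A.mul_mem a b ha hb, ?_,
    ⟨1, one_ne_zero, fun a ha b hb => by simpa using A.add_mem a b ha hb⟩, ?_⟩
  · intro a ha
    exact (A.mem_or_inv_mem a).resolve_left ha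
  · by_contra! hc
    exact hn (Set.eq_univ_of_forall hc)

theorem vb_abs {O : Set K} (h : IsAbsLocality O) (hn : O ≠ Set.univ) : VB O := by
  obtain ⟨f, rfl⟩ := h
  have hnt : ∃ w, w ∉ {x | f x ≤ 1} := by
    by_contra! hc
    exact hn (Set.eq_univ_of_forall hc)
  refine ⟨by simp, fun a ha => by simpa using ha, fun a ha b hb => ?_, ?_, ?_, hnt⟩
  · simp only [Set.mem_setOf_eq, map_mul] at *
    exact mul_le_one₀ ha (f.nonneg b) hb
  · intro a ha
    simp only [Set.mem_setOf_eq, not_le, map_inv₀] at *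
    exact inv_le_one_of_one_le₀ ha.le
  · obtain ⟨w, hw⟩ := hnt
    simp only [Set.mem_setOf_eq, not_le] at hw
    have hw0 : w ≠ 0 := by
      rintro rfl
      simp at hw
      linarith
    obtain ⟨k, hk⟩ := pow_unbounded_of_one_lt 2 hw
    refine ⟨(w ^ k)⁻¹, inv_ne_zero (pow_ne_zero _ hw0), fun a ha b hb => ?_⟩
    simp only [Set.mem_setOf_eq, map_mul, map_inv₀, map_pow] at *
    have h1 := f.add_le a b
    rw [inv_mul_le_iff₀ (by linarith)]
    linarith

theorem vb_ord {O : Set K} (h : IsOrderingLocality O) (hn : O ≠ Set.univ) : VB O := by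
  obtain ⟨P, ⟨hadd, hmul, htot, hanti⟩, rfl⟩ := h
  have hsq : ∀ a : K, a * a ∈ P := by
    intro a
    rcases htot a with h | h
    · exact hmul a h a h
    · simpa using hmul _ h _ h
  have h1 : (1 : K) ∈ P := by simpa using hsq 1
  have hm1 : (-1 : K) ∉ P := fun h => one_ne_zero (hanti 1 h1 h)
  have h2 : (2 : K) ≠ 0 := by
    intro h
    apply hm1
    have : (-1 : K) = 1 := by linear_combination -h
    rw [this]; exact h1
  have hhalf : (2⁻¹ : K) ∈ P := by
    have : (2⁻¹ : K) = (1 + 1) * (2⁻¹ * 2⁻¹) := by field_simp; norm_num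
    rw [this]
    exact hmul _ (hadd _ h1 _ h1) _ (hsq _)
  have hneg : ∀ a ∈ orderingBall P, -a ∈ orderingBall P := by
    rintro a ⟨h1, h2⟩
    refine ⟨?_, ?_⟩
    · convert h2 using 1; ring
    · convert h1 using 1; ring
  have hpos : ∀ a, a ∈ P → a ∉ orderingBall P → a⁻¹ ∈ orderingBall P := by
    intro a ha hna
    have hx : a - 1 ∈ P := by
      rcases htot (a - 1) with h | h
      · exact h
      · exact absurd ⟨hadd _ ha _ h1, by convert h using 1; ring⟩ hna
    have ha0 : a ≠ 0 := by
      rintro rfl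
      exact hm1 (by simpa using hx)
    have hi : a⁻¹ ∈ P := by
      have : a⁻¹ = a * (a⁻¹ * a⁻¹) := by field_simp
      rw [this]
      exact hmul _ ha _ (hsq _)
    refine ⟨hadd _ hi _ h1, ?_⟩
    have : 1 - a⁻¹ = (a - 1) * a⁻¹ := by field_simp
    rw [this]
    exact hmul _ hx _ hi
  refine ⟨?_, hneg, ?_, ?_, ⟨2⁻¹, inv_ne_zero h2, ?_⟩, ?_⟩
  · refine ⟨hadd _ h1 _ h1, ?_⟩
    have : (1 - 1 : K) = 0 * 0 := by ring
    rw [this]; exact hsq 0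
  · rintro a ⟨ha1, ha2⟩ b ⟨hb1, hb2⟩
    refine ⟨?_, ?_⟩
    · have : a * b + 1 = 2⁻¹ * ((a + 1) * (b + 1) + (1 - a) * (1 - b)) := by field_simp; ring
      rw [this]
      exact hmul _ hhalf _ (hadd _ (hmul _ ha1 _ hb1) _ (hmul _ ha2 _ hb2))
    · have : 1 - a * b = 2⁻¹ * ((a + 1) * (1 - b) + (1 - a) * (b + 1)) := by field_simp; ring
      rw [this]
      exact hmul _ hhalf _ (hadd _ (hmul _ ha1 _ hb2) _ (hmul _ ha2 _ hb1))
  · intro a ha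
    rcases htot a with h | h
    · exact hpos a h ha
    · have := hneg _ (hpos (-a) h (fun h' => ha (by simpa using hneg _ h')))
      simpa [inv_neg] using this
  · rintro a ⟨ha1, ha2⟩ b ⟨hb1, hb2⟩
    refine ⟨?_, ?_⟩
    · have : 2⁻¹ * (a + b) + 1 = 2⁻¹ * ((a + 1) + (b + 1)) := by field_simp; ring
      rw [this]
      exact hmul _ hhalf _ (hadd _ ha1 _ hb1)
    · have : 1 - 2⁻¹ * (a + b) = 2⁻¹ * ((1 - a) + (1 - b)) := by field_simp; ring
      rw [this]
      exact hmul _ hhalf _ (hadd _ ha2 _ hb2)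
  · by_contra! hc
    exact hn (Set.eq_univ_of_forall hc)

theorem vb_loc {O : Set K} (h : IsLocality O) (hn : O ≠ Set.univ) : VB O := by
  rcases h with h | h | h
  · exact vb_val h hn
  · exact vb_ord h hn
  · exact vb_abs h hn

/-- `x ∈ z·O`. -/
def BB (O : Set K) (z x : K) : Prop := z⁻¹ * x ∈ O

theorem BB.mul {O : Set K} (h : VB O) {z x w y : K} (h1 : BB O z x) (h2 : BB O w y) :
    BB O (z * w) (x * y) := by
  have := h.mul _ h1 _ h2
  unfold BB
  convert this using 1
  rw [mul_inv]; ring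

theorem BB.mul_eq {O : Set K} (h : VB O) {z x w y : K} (h1 : BB O z x) (h2 : BB O w y)
    {r t : K} (hr : r = z * w) (ht : t = x * y) : BB O r t := by
  subst hr ht; exact h1.mul h h2

theorem BB.neg {O : Set K} (h : VB O) {z x : K} (h1 : BB O z x) : BB O z (-x) := by
  have := h.neg _ h1
  unfold BB
  simpa using this

theorem BB.zero {O : Set K} (h : VB O) (z : K) : BB O z 0 := by
  unfold BB
  simpa using h.zero

theorem BB.self {O : Set K} (h : VB O) {z : K} (hz : z ≠ 0) : BB O z z := by
  unfold BB
  rw [inv_mul_cancel₀ hz]; exact h.one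

theorem BB.inv {O : Set K} (h : VB O) {z x : K} (h1 : ¬ BB O z x) : BB O z⁻¹ x⁻¹ := by
  have := h.inv _ h1
  unfold BB
  simpa [mul_comm] using this

theorem BB.ne {O : Set K} (h : VB O) {z x : K} (h1 : ¬ BB O z x) : x ≠ 0 := by
  rintro rfl
  exact h1 (BB.zero h z)

theorem BB.add {O : Set K} (h : VB O) : ∃ c : K, c ≠ 0 ∧ ∀ z a b,
    BB O (c * z) a → BB O (c * z) b → BB O z (a + b) := by
  obtain ⟨c, hc, H⟩ := h.add
  refine ⟨c, hc, fun z a b ha hb => ?_⟩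
  have := H _ ha _ hb
  unfold BB
  convert this using 1
  rw [mul_inv]; field_simp

theorem exists_not {O : Set K} (h : VB O) {z : K} (hz : z ≠ 0) : ∃ x, ¬ BB O z x := by
  obtain ⟨w, hw⟩ := h.nontriv
  refine ⟨z * w, ?_⟩
  unfold BB
  rwa [inv_mul_cancel_left₀ hz]

theorem BB.trans {O : Set K} (h : VB O) {a b x : K} (hb : b ≠ 0) (h1 : BB O a b)
    (h2 : BB O b x) : BB O a x :=
  (h1.mul h h2).mul_eq h (BB.self h (inv_ne_zero hb)) (by field_simp) (by field_simp)

theorem small {O : Set K} (h : VB O) {a b : K} (ha : a ≠ 0) (hb : b ≠ 0) :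
    ∃ u : K, u ≠ 0 ∧ ∀ x, BB O u x → BB O a x ∧ BB O b x := by
  by_cases hab : BB O a b
  · exact ⟨b, hb, fun x hx => ⟨hab.trans h hb hx, hx⟩⟩
  · have h1 : BB O b a := by
      unfold BB
      simpa [mul_comm] using h.inv _ hab
    exact ⟨a, ha, fun x hx => ⟨hx, h1.trans h ha hx⟩⟩

theorem big {O : Set K} (h : VB O) {a b : K} (ha : a ≠ 0) (hb : b ≠ 0) :
    ∃ u : K, u ≠ 0 ∧ ∀ x, BB O a x ∨ BB O b x → BB O u x := by
  by_cases hab : BB O a b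
  · exact ⟨a, ha, fun x hx => hx.elim id fun hx => hab.trans h hb hx⟩
  · have h1 : BB O b a := by
      unfold BB
      simpa [mul_comm] using h.inv _ hab
    exact ⟨b, hb, fun x hx => hx.elim (fun hx => h1.trans h ha hx) id⟩

theorem sep {O : Set K} (h : VB O) :
    ∃ s : K, s ≠ 0 ∧ ∀ a b, a + b = 1 → BB O s a → ¬ BB O s b := by
  obtain ⟨c, hc, H⟩ := BB.add h
  obtain ⟨w, hw⟩ := h.nontriv
  have hw0 : w ≠ 0 := by rintro rfl; exact hw h.zero
  refine ⟨c * w⁻¹, mul_ne_zero hc (inv_ne_zero hw0), fun a b hab h1 h2 => hw ?_⟩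
  have := H _ a b h1 h2
  rw [hab] at this
  simpa [BB] using this

theorem m_of {O : Set K} (h : VB O) : ∃ p : K, p ≠ 0 ∧ ∀ z x, z ≠ 0 → BB O (z * p) x →
    x ∈ scale z (mball O) := by
  obtain ⟨w, hw⟩ := h.nontriv
  have hw0 : w ≠ 0 := by rintro rfl; exact hw h.zero
  refine ⟨w⁻¹, inv_ne_zero hw0, fun z x hz hx => ⟨z⁻¹ * x, ⟨?_, ?_⟩, by field_simp⟩⟩
  · have := h.mul _ hx _ (h.inv w hw)
    convert this using 1
    rw [mul_inv]; field_simp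
  · rintro ⟨-, h0, h1⟩
    apply hw
    have := h.mul _ hx _ h1
    have hx0 : x ≠ 0 := by rintro rfl; simp at h0
    convert this using 1
    field_simp

theorem incl {O₁ O₂ : Set K} (h1 : VB O₁) (h2 : VB O₂) {y z : K} (hy : y ≠ 0) (hz : z ≠ 0)
    (H : ∀ x, BB O₁ z x → BB O₂ y x) (t : K) (ht : t ≠ 0) :
    ∃ z' : K, z' ≠ 0 ∧ scale z' (mball O₁) ⊆ scale t (mball O₂) := by
  obtain ⟨p, hp, Hp⟩ := m_of h2
  refine ⟨z * (t * p * y⁻¹), by simp [*], ?_⟩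
  rintro _ ⟨m, hm, rfl⟩
  apply Hp _ _ ht
  have := H (z * m) (by unfold BB; rw [inv_mul_cancel_left₀ hz]; exact hm.1)
  exact this.mul_eq h2 (BB.self h2 (z := t * p * y⁻¹) (by simp [*])) (by field_simp) (by ring)

theorem minimal {O₁ O₂ : Set K} (h1 : VB O₁) (h2 : VB O₂) {y z : K} (hy : y ≠ 0) (hz : z ≠ 0)
    (H : ∀ x, BB O₁ z x → BB O₂ y x) :
    ∃ y' z' : K, y' ≠ 0 ∧ z' ≠ 0 ∧ ∀ x, BB O₂ z' x → BB O₁ y' x := by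
  obtain ⟨w, hw⟩ := exists_not h2 hy
  have hw0 := BB.ne h2 hw
  refine ⟨w * z⁻¹, 1, by simp [*], one_ne_zero, fun x hx => ?_⟩
  by_contra hc
  have hx0 := BB.ne h1 hc
  apply hw
  have := H (w * x⁻¹) ((BB.inv h1 hc).mul_eq h1 (BB.self h1 hw0) (by field_simp) (by ring))
  exact this.mul_eq h2 hx (by simp) (by field_simp)

theorem indep {O₁ O₂ : Set K} (h1 : VB O₁) (h2 : VB O₂) (hi : IndepLoc O₁ O₂) (y z : K)
    (hy : y ≠ 0) (hz : z ≠ 0) : ∃ x, BB O₁ z x ∧ ¬ BB O₂ y x := by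
  by_contra! H
  obtain ⟨y', z', hy', hz', H'⟩ := minimal h1 h2 hy hz H
  exact hi ⟨incl h2 h1 hy' hz' H', incl h1 h2 hy hz H⟩

/-- Approximation on a finite set of indices. -/
def AA {ι : Type*} (v : ι → Set K) (S : Finset ι) : Prop :=
  ∀ x z : ι → K, (∀ i, z i ≠ 0) → ∃ a, ∀ i ∈ S, BB (v i) (z i) (a - x i)

/-- Elements small on `S` and large at `k`. -/
def PP {ι : Type*} (v : ι → Set K) (S : Finset ι) (k : ι) : Prop :=
  ∀ (z : ι → K) (y : K), (∀ i, z i ≠ 0) → y ≠ 0 →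
    ∃ a, (∀ i ∈ S, BB (v i) (z i) a) ∧ ¬ BB (v k) y a

theorem AA.mono {ι : Type*} {v : ι → Set K} {S T : Finset ι} (h : AA v S) (hT : T ⊆ S) :
    AA v T := fun x z hz => by
  obtain ⟨a, ha⟩ := h x z hz
  exact ⟨a, fun i hi => ha i (hT hi)⟩

theorem stepP {ι : Type*} [DecidableEq ι] (v : ι → Set K) (hv : ∀ i, VB (v i))
    (hind : ∀ i j, i ≠ j → IndepLoc (v i) (v j)) (k : ι) (S : Finset ι) (hk : k ∉ S)
    (hA : AA v S) : PP v S k := by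
  induction S using Finset.induction_on with
  | empty =>
    intro z y hz hy
    obtain ⟨x, hx⟩ := exists_not (hv k) hy
    exact ⟨x, by simp, hx⟩
  | insert j T hj ih =>
    have ihT := ih (fun h => hk (Finset.mem_insert_of_mem h)) (hA.mono (Finset.subset_insert _ _))
    intro z y hz hy
    have hjk : j ≠ k := by rintro rfl; exact hk (Finset.mem_insert_self _ _)
    choose c hc Hc using fun i => BB.add (hv i)
    obtain ⟨s, hs, Hs⟩ := sep (hv k)
    have hcz : ∀ i, c i * z i ≠ 0 := fun i => mul_ne_zero (hc i) (hz i)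
    have hys : y * s⁻¹ ≠ 0 := by simp [*]
    obtain ⟨x, hx1, hx2⟩ := ihT (fun i => c i * z i) (y * s⁻¹) hcz hys
    obtain ⟨x', hx1', hx2'⟩ := indep (hv j) (hv k) (hind j k hjk) (y * s⁻¹) (c j * z j) hys (hcz j)
    have hx0 := BB.ne (hv k) hx2
    have hx0' := BB.ne (hv k) hx2'
    choose u hu Hu using fun i => small (hv i) one_ne_zero
      (b := z i * (if i = j then x else x')⁻¹) (by split_ifs <;> simp [*])
    obtain ⟨e, he⟩ := hA (fun i => if i = j then 0 else 1) u hu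
    have key : ∀ g d, ¬ BB (v k) s g → ¬ BB (v k) (y * s⁻¹) d → ¬ BB (v k) y (g * d) := by
      intro g d hg hd h
      have hg0 := BB.ne (hv k) hg
      exact hd (h.mul_eq (hv k) (BB.inv (hv k) hg) rfl (by field_simp))
    have key2 : ∀ i g d, BB (v i) 1 (g - 1) → BB (v i) (c i * z i) d → BB (v i) (z i) (g * d) := by
      intro i g d hg hd
      have h1 : g * d = (g - 1) * d + d := by ring
      rw [h1]
      exact Hc i _ _ _ (hg.mul_eq (hv i) hd (by simp) rfl) hd
    have key3 : ∀ i g d, d ≠ 0 → BB (v i) (z i * d⁻¹) g → BB (v i) (z i) (g * d) := by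
      intro i g d hd h
      exact h.mul_eq (hv i) (BB.self (hv i) hd) (by field_simp) rfl
    have hej := Hu j _ (he j (Finset.mem_insert_self _ _))
    simp only [if_true, sub_zero] at hej
    have heT : ∀ i ∈ T, BB (v i) 1 (e - 1) ∧ BB (v i) (z i * x'⁻¹) (e - 1) := by
      intro i hi
      have hij : i ≠ j := by rintro rfl; exact hj hi
      have := Hu i _ (he i (Finset.mem_insert_of_mem hi))
      simpa only [if_neg hij] using this
    by_cases hes : BB (v k) s e
    · refine ⟨(1 - e) * x', ?_, key _ _ (Hs e (1 - e) (by ring) hes) hx2'⟩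
      intro i hi
      rcases Finset.mem_insert.1 hi with rfl | hi
      · exact key2 _ _ _ (by convert hej.1.neg (hv _) using 1; ring) hx1'
      · exact key3 _ _ _ hx0' (by convert (heT i hi).2.neg (hv _) using 1; ring)
    · refine ⟨e * x, ?_, key _ _ hes hx2⟩
      intro i hi
      rcases Finset.mem_insert.1 hi with rfl | hi
      · exact key3 _ _ _ hx0 hej.2
      · exact key2 _ _ _ (heT i hi).1 (hx1 i hi)

theorem stepA {ι : Type*} [DecidableEq ι] (v : ι → Set K) (hv : ∀ i, VB (v i))
    (k : ι) (S : Finset ι) (hk : k ∉ S)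
    (hA : AA v S) (hP : PP v S k) : AA v (insert k S) := by
  intro x z hz
  choose c hc Hc using fun i => BB.add (hv i)
  have hcz : ∀ i, c i * z i ≠ 0 := fun i => mul_ne_zero (hc i) (hz i)
  obtain ⟨a, ha⟩ := hA x (fun i => c i * z i) hcz
  by_cases hd : x k - a = 0
  · refine ⟨x k, fun i hi => ?_⟩
    rcases Finset.mem_insert.1 hi with rfl | hi
    · simpa using BB.zero (hv _) _
    · rw [sub_eq_zero.1 hd]
      have h0 := Hc i _ _ _ (ha i hi) (BB.zero (hv i) _)
      simpa using h0
  set d := x k - a with hdd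
  choose s hs Hs using fun i => sep (hv i)
  choose w hw Hw using fun i => small (hv i) (hs i) (b := s i * (c i * z i * d⁻¹))
    (mul_ne_zero (hs i) (mul_ne_zero (hcz i) (inv_ne_zero hd)))
  obtain ⟨u, hu, Hu⟩ := big (hv k) (one_ne_zero) (b := (z k * d⁻¹)⁻¹) (by simp [hz k, hd])
  obtain ⟨t, ht1, ht2⟩ := hP w ((c k)⁻¹ * u) hw (by simp [hc k, hu])
  have hbig : ¬ BB (v k) (z k * d⁻¹)⁻¹ (1 + t) := by
    intro h
    apply ht2
    have e1 : t = (1 + t) + (-1) := by ring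
    rw [e1]
    have e2 : c k * ((c k)⁻¹ * u) = u := by rw [mul_inv_cancel_left₀ (hc k)]
    apply Hc k <;> rw [e2]
    · exact Hu _ (Or.inr h)
    · exact Hu _ (Or.inl ((BB.self (hv k) one_ne_zero).neg (hv k)))
  have ht0 := BB.ne (hv k) hbig
  refine ⟨a + t * (1 + t)⁻¹ * d, fun i hi => ?_⟩
  rcases Finset.mem_insert.1 hi with rfl | hi
  · have e1 : a + t * (1 + t)⁻¹ * d - x i = -((1 + t)⁻¹ * d) := by
      have : x i = a + d := by rw [hdd]; ring
      rw [this]; field_simp; ring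
    rw [e1]
    apply BB.neg (hv i)
    exact (BB.inv (hv i) hbig).mul_eq (hv i) (BB.self (hv i) hd) (by field_simp) rfl
  · have e1 : a + t * (1 + t)⁻¹ * d - x i = (a - x i) + t * (1 + t)⁻¹ * d := by ring
    rw [e1]
    apply Hc i _ _ _ (ha i hi)
    obtain ⟨q1, q2⟩ := Hw i t (ht1 i hi)
    have q3 := Hs i (-t) (1 + t) (by ring) (q1.neg (hv i))
    have hsi := hs i
    exact (q2.mul (hv i) (BB.inv (hv i) q3)).mul_eq (hv i) (BB.self (hv i) hd)
      (by field_simp) rfl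

theorem allA {ι : Type*} [DecidableEq ι] (v : ι → Set K) (hv : ∀ i, VB (v i))
    (hind : ∀ i j, i ≠ j → IndepLoc (v i) (v j)) (S : Finset ι) : AA v S := by
  induction S using Finset.induction_on with
  | empty => intro x z hz; exact ⟨0, by simp⟩
  | insert j T hj ih => exact stepA v hv j T hj ih (stepP v hv hind j T hj ih)

/-- **Approximation for pairwise independent localities** (Theorem 1.8).
Nontrivial pairwise independent localities `v 1, …, v n`, `x i ∈ K`, `z i ∈ K^×`:
there is `x` with `x - x i ∈ z i · m_{v i}` for all `i`. -/
theorem approx_pairwise_independent {K : Type*} [Field K] (n : ℕ) (v : Fin n → Set K)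
    (hloc : ∀ i, IsLocality (v i)) (hnontriv : ∀ i, v i ≠ (Set.univ : Set K))
    (hindep : ∀ i j, i ≠ j → IndepLoc (v i) (v j))
    (x : Fin n → K) (z : Fin n → K) (hz : ∀ i, z i ≠ 0) :
    ∃ a : K, ∀ i, a - x i ∈ scale (z i) (mball (v i)) := by
  have hv : ∀ i, VB (v i) := fun i => vb_loc (hloc i) (hnontriv i)
  choose p hp Hp using fun i => m_of (hv i)
  obtain ⟨a, ha⟩ := allA v hv hindep Finset.univ x (fun i => z i * p i)
    (fun i => mul_ne_zero (hz i) (hp i))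
  exact ⟨a, fun i => Hp i _ _ (hz i) (ha i (Finset.mem_univ i))⟩

end PaperApprox
end

section
/- Let K be a field, let v_1 and v_2 be localities on K, and let z_1, z_2 ∈ K^× be such that z_1·O_w = z_2·O_w for the finest common coarsening w = v_1 ∨ v_2. Then: (1) if v_1 and v_2 are strongly incomparable, there exists z ∈ K^× with z ∈ z_1·m_{v_1} and z^{−1} ∈ z_2^{−1}·m_{v_2}; (2) if v_1 and v_2 are comparable or strongly incomparable (which holds in particular if at least one of them is a valuation), there exists z ∈ K^× with z ∈ z_1·O_{v_1} and z^{−1} ∈ z_2^{−1}·O_{v_2}. -/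
namespace PaperApprox

variable {K : Type*} [Field K]

/-- A concrete consequence list of being a locality. -/
structure Nice (O : Set K) : Prop where
  one_mem : (1 : K) ∈ O
  neg_mem : ∀ x ∈ O, -x ∈ O
  mul_mem : ∀ x ∈ O, ∀ y ∈ O, x * y ∈ O
  total : ∀ x : K, x ∈ O ∨ x⁻¹ ∈ O
  add : ∃ N : ℕ, ∀ x ∈ O, ∀ y ∈ O, ∃ c ∈ O, x + y = N * c

/-- Archimedean absolute value ball. -/
def IsArch (O : Set K) : Prop :=
  ∃ f : AbsoluteValue K ℝ, O = {x | f x ≤ 1} ∧ ∃ n : ℕ, 1 < f n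

theorem abs_valuation (f : AbsoluteValue K ℝ) (h : ∀ n : ℕ, f n ≤ 1) :
    IsValuationLocality {x | f x ≤ 1} := by
  letI := f.toNormedField
  have hn : ∀ x : K, ‖x‖ = f x := fun x => rfl
  haveI : IsUltrametricDist K :=
    IsUltrametricDist.isUltrametricDist_of_forall_norm_natCast_le_one (R := K) h
  have hadd : ∀ a b : K, f a ≤ 1 → f b ≤ 1 → f (a + b) ≤ 1 := by
    intro a b ha hb
    have := IsUltrametricDist.norm_add_le_max a b
    rw [hn, hn, hn] at this
    exact this.trans (max_le ha hb)
  exact ⟨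
    { carrier := {x | f x ≤ 1}
      mul_mem' := fun {a b} ha hb => by
        simp only [Set.mem_ofPred_eq, map_mul] at *
        exact mul_le_one₀ ha (f.nonneg b) hb
      one_mem' := by simp
      add_mem' := fun {a b} ha hb => hadd a b ha hb
      zero_mem' := by simp
      neg_mem' := fun {a} ha => by simpa using ha
      mem_or_inv_mem' := fun x => by
        simp only [Set.mem_ofPred_eq, map_inv₀]
        rcases le_total (f x) 1 with h | h
        · exact Or.inl h
        · exact Or.inr (inv_le_one_of_one_le₀ h) }, rfl⟩

theorem IsLocality.cases {O : Set K} (h : IsLocality O) :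
    IsValuationLocality O ∨ IsOrderingLocality O ∨ IsArch O := by
  rcases h with h | h | ⟨f, rfl⟩
  · exact Or.inl h
  · exact Or.inr (Or.inl h)
  · by_cases hn : ∀ n : ℕ, f n ≤ 1
    · exact Or.inl (abs_valuation f hn)
    · push Not at hn
      exact Or.inr (Or.inr ⟨f, rfl, hn⟩)

theorem ordering_exists {O : Set K} (h : IsOrderingLocality O) :
    ∃ (_ : LinearOrder K) (_ : IsStrictOrderedRing K), O = {x | |x| ≤ 1} := by
  classical
  obtain ⟨P, ⟨hadd, hmul, htot, hz⟩, rfl⟩ := h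
  have h0 : (0 : K) ∈ P := by rcases htot 0 with h | h <;> simpa using h
  have h1 : (1 : K) ∈ P := by
    rcases htot 1 with h | h
    · exact h
    · simpa using hmul _ h _ h
  letI l : LinearOrder K :=
    { le := fun a b => b - a ∈ P
      le_refl := fun a => by simpa using h0
      le_trans := fun a b c hab hbc => by
        have := hadd _ hab _ hbc
        simpa using this
      le_antisymm := fun a b hab hba => by
        have := hz _ hab (by simpa using hba)
        exact (sub_eq_zero.mp this).symm
      le_total := fun a b => by
        rcases htot (b - a) with h | h
        · exact Or.inl h
        · exact Or.inr (by simpa using h)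
      toDecidableLE := Classical.decRel _ }
  have hle : ∀ a b : K, a ≤ b ↔ b - a ∈ P := fun _ _ => Iff.rfl
  haveI : IsOrderedAddMonoid K :=
    { add_le_add_left := fun a b hab c => by
        rw [hle] at *
        simpa using hab }
  haveI : ZeroLEOneClass K := ⟨by rw [hle]; simpa using h1⟩
  haveI : IsOrderedRing K := .of_mul_nonneg fun x y hx hy => by
    rw [hle] at *
    simpa using hmul _ (by simpa using hx) _ (by simpa using hy)
  haveI : IsStrictOrderedRing K := IsOrderedRing.toIsStrictOrderedRing K
  refine ⟨l, inferInstance, ?_⟩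
  ext x
  simp only [orderingBall, Set.mem_ofPred_eq, abs_le]
  rw [hle, hle]
  simp

theorem IsLocality.nice {O : Set K} (h : IsLocality O) : Nice O := by
  rcases h.cases with ⟨A, rfl⟩ | h | ⟨f, rfl, n, hn⟩
  · refine ⟨A.one_mem, fun x hx => A.neg_mem _ hx, fun x hx y hy => A.mul_mem _ _ hx hy,
      A.mem_or_inv_mem, 1, fun x hx y hy => ⟨x + y, A.add_mem _ _ hx hy, by simp⟩⟩
  · obtain ⟨l, hs, rfl⟩ := ordering_exists h
    refine ⟨by simp, fun x hx => by simpa using hx, fun x hx y hy => ?_, fun x => ?_, 2,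
      fun x hx y hy => ⟨(x + y) / 2, ?_, ?_⟩⟩
    · simp only [Set.mem_ofPred_eq, abs_mul] at *
      exact mul_le_one₀ hx (abs_nonneg y) hy
    · simp only [Set.mem_ofPred_eq, abs_inv]
      rcases le_total |x| 1 with h | h
      · exact Or.inl h
      · exact Or.inr (inv_le_one_of_one_le₀ h)
    · simp only [Set.mem_ofPred_eq, abs_le] at *
      constructor
      · linarith [hx.1, hy.1]
      · linarith [hx.2, hy.2]
    · push_cast
      field_simp
  · obtain ⟨k, hk⟩ := pow_unbounded_of_one_lt 2 hn
    refine ⟨by simp, fun x hx => by simpa using hx, fun x hx y hy => ?_, fun x => ?_, n ^ k,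
      fun x hx y hy => ⟨(x + y) / (n ^ k), ?_, ?_⟩⟩
    · simp only [Set.mem_ofPred_eq, map_mul] at *
      exact mul_le_one₀ hx (f.nonneg y) hy
    · simp only [Set.mem_ofPred_eq, map_inv₀]
      rcases le_total (f x) 1 with h | h
      · exact Or.inl h
      · exact Or.inr (inv_le_one_of_one_le₀ h)
    · simp only [Set.mem_ofPred_eq, map_div₀, map_pow] at *
      rw [div_le_one (by positivity)]
      linarith [f.add_le x y]
    · have : (n : K) ≠ 0 := by
        rintro h
        rw [h, map_zero] at hn
        linarith
      push_cast
      field_simp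

theorem Nice.zero_mem {O : Set K} (h : Nice O) : (0 : K) ∈ O := by
  simpa using h.total 0

theorem Nice.pow_mem {O : Set K} (h : Nice O) {x : K} (hx : x ∈ O) (n : ℕ) : x ^ n ∈ O := by
  induction n with
  | zero => simpa using h.one_mem
  | succ n ih => rw [pow_succ]; exact h.mul_mem _ ih _ hx

theorem Nice.mul_mball {O : Set K} (h : Nice O) {s t : K} (hs : s ∈ O) (hs0 : s ≠ 0)
    (ht : t ∈ O) (ht' : t⁻¹ ∉ O) : s * t ∈ O ∧ (s * t)⁻¹ ∉ O := by
  refine ⟨h.mul_mem _ hs _ ht, fun hh => ht' ?_⟩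
  have := h.mul_mem _ hs _ hh
  rwa [mul_inv, mul_inv_cancel_left₀ hs0] at this

/-- A locality contained in a locality that is not a valuation ring is equal to it. -/
theorem eq_of_subset {O W : Set K} (hO : IsLocality O) (hW : IsLocality W)
    (hsub : O ⊆ W) (hv : ¬ IsValuationLocality W) : W ⊆ O := by
  intro x hx
  by_contra hxO
  have hxi : x⁻¹ ∈ O := (hO.nice.total x).resolve_left hxO
  have hxi' := hsub hxi
  rcases hW.cases with h | h | ⟨f, rfl, n, hn⟩
  · exact hv h
  · obtain ⟨l, hs, rfl⟩ := ordering_exists h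
    simp only [Set.mem_ofPred_eq, abs_inv] at hx hxi'
    have hx0 : x ≠ 0 := by
      rintro rfl
      exact hxO hO.nice.zero_mem
    have : 1 ≤ |x| := (inv_le_one₀ (abs_pos.mpr hx0)).mp hxi'
    have h1 : |x| = 1 := le_antisymm hx this
    rcases (abs_eq zero_le_one).mp h1 with rfl | rfl
    · exact hxO hO.nice.one_mem
    · exact hxO (hO.nice.neg_mem _ hO.nice.one_mem)
  · have hx0 : x ≠ 0 := by
      rintro rfl
      exact hxO hO.nice.zero_mem
    simp only [Set.mem_ofPred_eq, map_inv₀] at hx hxi'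
    have h1 : f x = 1 := le_antisymm hx ((inv_le_one₀ (f.pos hx0)).mp hxi')
    rcases hO.cases with ⟨A, rfl⟩ | h | ⟨g, rfl, -⟩
    · have := hsub (natCast_mem A n)
      simp only [Set.mem_ofPred_eq] at this
      linarith
    · obtain ⟨l, hs, rfl⟩ := ordering_exists h
      simp only [Set.mem_ofPred_eq, not_le] at hxO
      obtain ⟨y, hy1, hfy⟩ : ∃ y : K, 1 < y ∧ f y = 1 := by
        rcases abs_cases x with ⟨h, -⟩ | ⟨h, -⟩
        · exact ⟨x, h ▸ hxO, h1⟩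
        · exact ⟨-x, h ▸ hxO, by simpa using h1⟩
      have key : ∀ m : ℕ, f m * f (y - 1) ≤ 1 := by
        intro m
        have hb := one_add_mul_le_pow (a := y - 1) (by linarith) m
        have hpos : (0 : K) < y ^ m := by positivity
        have hm0 : (0 : K) ≤ m * (y - 1) := mul_nonneg (Nat.cast_nonneg m) (by linarith)
        have hmem : (m : K) * (y - 1) / y ^ m ∈ {x : K | |x| ≤ 1} := by
          simp only [Set.mem_ofPred_eq]
          rw [abs_of_nonneg (by positivity), div_le_one hpos]
          rw [add_sub_cancel] at hb
          linarith
        have := hsub hmem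
        simpa [hfy] using this
      have hp : 0 < f (y - 1) := f.pos (by
        intro h
        linarith)
      obtain ⟨k, hk⟩ := pow_unbounded_of_one_lt (1 / f (y - 1)) hn
      have := key (n ^ k)
      rw [div_lt_iff₀ hp] at hk
      push_cast at this
      rw [map_pow] at this
      linarith
    · simp only [Set.mem_ofPred_eq, not_le] at hxO
      obtain ⟨k, hk⟩ := pow_unbounded_of_one_lt (g n) hxO
      have hmem : (n : K) / x ^ k ∈ {x : K | g x ≤ 1} := by
        simp only [Set.mem_ofPred_eq, map_div₀, map_pow]
        rw [div_le_one (by positivity)]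
        exact hk.le
      have := hsub hmem
      simp only [Set.mem_ofPred_eq, map_div₀, map_pow, h1, one_pow, div_one] at this
      linarith

/-- The ring generated by two localities. -/
def joinSet (O₁ O₂ : Set K) : Set K :=
  {x | ∃ N : ℕ, ∃ a ∈ O₁, ∃ b ∈ O₂, x = N * (a * b)}

theorem joinSet_mul {O₁ O₂ : Set K} (h₁ : Nice O₁) (h₂ : Nice O₂) {x y : K}
    (hx : x ∈ joinSet O₁ O₂) (hy : y ∈ joinSet O₁ O₂) : x * y ∈ joinSet O₁ O₂ := by
  obtain ⟨N, a, ha, b, hb, rfl⟩ := hx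
  obtain ⟨N', a', ha', b', hb', rfl⟩ := hy
  refine ⟨N * N', a * a', h₁.mul_mem _ ha _ ha', b * b', h₂.mul_mem _ hb _ hb', ?_⟩
  push_cast
  ring

theorem subset_joinSet_left {O₁ O₂ : Set K} (h₂ : Nice O₂) : O₁ ⊆ joinSet O₁ O₂ :=
  fun x hx => ⟨1, x, hx, 1, h₂.one_mem, by simp⟩

theorem subset_joinSet_right {O₁ O₂ : Set K} (h₁ : Nice O₁) : O₂ ⊆ joinSet O₁ O₂ :=
  fun x hx => ⟨1, 1, h₁.one_mem, x, hx, by simp⟩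

theorem joinSet_add {O₁ O₂ : Set K} (h₁ : Nice O₁) (h₂ : Nice O₂) {x y : K}
    (hx : x ∈ joinSet O₁ O₂) (hy : y ∈ joinSet O₁ O₂) : x + y ∈ joinSet O₁ O₂ := by
  have key : ∀ x y : K, y ∈ joinSet O₁ O₂ → y ≠ 0 → x / y ∈ O₁ → x + y ∈ joinSet O₁ O₂ := by
    intro x y hy hy0 hxy
    obtain ⟨N, hN⟩ := h₁.add
    obtain ⟨c, hc, hc'⟩ := hN _ hxy _ h₁.one_mem
    have : x + y = (x / y + 1) * y := by field_simp
    rw [this]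
    exact joinSet_mul h₁ h₂ ⟨N, c, hc, 1, h₂.one_mem, by rw [hc']; ring⟩ hy
  by_cases hx0 : x = 0
  · simpa [hx0] using hy
  by_cases hy0 : y = 0
  · simpa [hy0] using hx
  rcases h₁.total (x / y) with h | h
  · exact key x y hy hy0 h
  · rw [add_comm]
    rw [inv_div] at h
    exact key y x hx hx0 h

/-- The join as a valuation ring. -/
def joinRing {O₁ O₂ : Set K} (h₁ : Nice O₁) (h₂ : Nice O₂) : ValuationSubring K where
  carrier := joinSet O₁ O₂
  mul_mem' := joinSet_mul h₁ h₂
  one_mem' := subset_joinSet_left h₂ h₁.one_mem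
  add_mem' := joinSet_add h₁ h₂
  zero_mem' := subset_joinSet_left h₂ h₁.zero_mem
  neg_mem' := by
    rintro x ⟨N, a, ha, b, hb, rfl⟩
    exact ⟨N, -a, h₁.neg_mem _ ha, b, hb, by ring⟩
  mem_or_inv_mem' := fun x => (h₁.total x).imp
    (fun h => subset_joinSet_left h₂ h) (fun h => subset_joinSet_left h₂ h)

theorem joinSet_isFCC {O₁ O₂ : Set K} (h₁ : IsLocality O₁) (h₂ : IsLocality O₂)
    (hinc : Incomp O₁ O₂) : IsFCC O₁ O₂ (joinSet O₁ O₂) := by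
  refine ⟨Or.inl ⟨joinRing h₁.nice h₂.nice, rfl⟩, subset_joinSet_left h₂.nice,
    subset_joinSet_right h₁.nice, fun W' hW' hs₁ hs₂ => ?_⟩
  by_cases hv : IsValuationLocality W'
  · obtain ⟨A, rfl⟩ := hv
    rintro x ⟨N, a, ha, b, hb, rfl⟩
    exact A.mul_mem _ _ (natCast_mem A N) (A.mul_mem _ _ (hs₁ ha) (hs₂ hb))
  · exact absurd (hs₁.trans (eq_of_subset h₂ hW' hs₂ hv)) hinc.1

theorem exists_sep {O₁ O₂ : Set K} (h₁ : Nice O₁) (h₂ : Nice O₂) (hinc : Incomp O₁ O₂) :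
    ∃ c : K, c ≠ 0 ∧ c ∈ O₁ ∧ c⁻¹ ∉ O₁ ∧ c⁻¹ ∈ O₂ ∧ c ∉ O₂ := by
  obtain ⟨⟨x, hx₁, hx₂⟩, ⟨y, hy₂, hy₁⟩⟩ :=
    And.intro (Set.not_subset.mp hinc.1) (Set.not_subset.mp hinc.2)
  have hx0 : x ≠ 0 := by
    rintro rfl
    exact hx₂ h₂.zero_mem
  have hy0 : y ≠ 0 := by
    rintro rfl
    exact hy₁ h₁.zero_mem
  have A := h₁.mul_mball hx₁ hx0 ((h₁.total y).resolve_left hy₁) (by rwa [inv_inv])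
  have B := h₂.mul_mball hy₂ hy0 ((h₂.total x).resolve_left hx₂) (by rwa [inv_inv])
  have e : (x * y⁻¹)⁻¹ = y * x⁻¹ := by simp [mul_comm]
  have e' : (y * x⁻¹)⁻¹ = x * y⁻¹ := by simp [mul_comm]
  refine ⟨x * y⁻¹, by simp [hx0, hy0], A.1, A.2, ?_, ?_⟩
  · rw [e]; exact B.1
  · rw [← e']; exact B.2

/-- every natural number is a product. -/
def NatProd (O₁ O₂ : Set K) : Prop := ∀ n : ℕ, ∃ a ∈ O₁, ∃ b ∈ O₂, (n : K) = a * b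

theorem NatProd.symm {O₁ O₂ : Set K} (h : NatProd O₁ O₂) : NatProd O₂ O₁ := fun n => by
  obtain ⟨a, ha, b, hb, e⟩ := h n
  exact ⟨b, hb, a, ha, by rw [e, mul_comm]⟩

theorem Incomp.symm {O₁ O₂ : Set K} (h : Incomp O₁ O₂) : Incomp O₂ O₁ := ⟨h.2, h.1⟩

theorem joinSet_comm (O₁ O₂ : Set K) : joinSet O₁ O₂ = joinSet O₂ O₁ := by
  ext x
  constructor <;>
  · rintro ⟨N, a, ha, b, hb, rfl⟩
    exact ⟨N, b, hb, a, ha, by ring⟩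

theorem natProd_of_valuation {O₁ O₂ : Set K} (h : IsValuationLocality O₁) (h₂ : Nice O₂) :
    NatProd O₁ O₂ := by
  obtain ⟨A, rfl⟩ := h
  exact fun n => ⟨n, natCast_mem A n, 1, h₂.one_mem, by simp⟩

theorem natProd_of_arch {O₁ O₂ : Set K} (h : IsArch O₁) (h₁ : Nice O₁) (h₂ : Nice O₂)
    (hinc : Incomp O₁ O₂) : NatProd O₁ O₂ := by
  obtain ⟨c, hc0, hc₁, hc₁', hc₂, -⟩ := exists_sep h₁ h₂ hinc
  obtain ⟨f, rfl, -⟩ := h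
  intro n
  simp only [Set.mem_ofPred_eq, map_inv₀, not_le] at hc₁ hc₁'
  obtain ⟨k, hk⟩ := pow_unbounded_of_one_lt (f n) hc₁'
  refine ⟨n * c ^ k, ?_, c⁻¹ ^ k, h₂.pow_mem hc₂ k, ?_⟩
  · have hp : 0 < f c := f.pos hc0
    simp only [Set.mem_ofPred_eq, map_mul, map_pow]
    have hpk : 0 < f c ^ k := by positivity
    calc f n * f c ^ k ≤ (f c)⁻¹ ^ k * f c ^ k := mul_le_mul_of_nonneg_right hk.le hpk.le
      _ = 1 := by rw [← mul_pow, inv_mul_cancel₀ hp.ne', one_pow]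
  · rw [mul_assoc, ← mul_pow, mul_inv_cancel₀ hc0, one_pow, mul_one]

theorem natProd_of_ordering_aux {O₁ O₂ : Set K} (h : IsOrderingLocality O₂)
    (h₁ : Nice O₁) (h₂ : Nice O₂) {x : K} (hx₁ : x ∈ O₁) (hx₂ : x ∉ O₂)
    (hp : (x - 1)⁻¹ ∈ joinSet O₁ O₂) (hm : (-x - 1)⁻¹ ∈ joinSet O₁ O₂) : NatProd O₁ O₂ := by
  obtain ⟨l, hs, rfl⟩ := ordering_exists h
  obtain ⟨y, hy, hy₁, hyj⟩ : ∃ y : K, 1 < y ∧ y ∈ O₁ ∧ (y - 1)⁻¹ ∈ joinSet O₁ {x | |x| ≤ 1} := by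
    simp only [Set.mem_ofPred_eq, not_le] at hx₂
    rcases abs_cases x with ⟨h, -⟩ | ⟨h, -⟩
    · exact ⟨x, h ▸ hx₂, hx₁, hp⟩
    · exact ⟨-x, h ▸ hx₂, h₁.neg_mem _ hx₁, hm⟩
  have hd : 0 < y - 1 := by linarith
  intro k
  by_cases hfin : ∃ n : ℕ, 1 ≤ n * (y - 1)
  · obtain ⟨n, hn⟩ := hfin
    have hb := one_add_mul_le_pow (a := y - 1) (by linarith) (n * k)
    rw [add_sub_cancel] at hb
    have hpos : (0 : K) < y ^ (n * k) := by positivity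
    refine ⟨y ^ (n * k), h₁.pow_mem hy₁ _, k / y ^ (n * k), ?_, by field_simp⟩
    simp only [Set.mem_ofPred_eq]
    rw [abs_of_nonneg (by positivity), div_le_one hpos]
    push_cast at hb
    have : (k : K) * 1 ≤ k * (n * (y - 1)) := mul_le_mul_of_nonneg_left hn (Nat.cast_nonneg k)
    linarith
  · push Not at hfin
    obtain ⟨N, a, ha, b, hb, e⟩ := hyj
    have hab : (N : K) * (a * b) * (y - 1) = 1 := by
      rw [← e]
      exact inv_mul_cancel₀ hd.ne'
    refine ⟨a, ha, ((k * N : ℕ) : K) * (y - 1) * b, h₂.mul_mem _ ?_ _ hb, ?_⟩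
    · simp only [Set.mem_ofPred_eq]
      rw [abs_of_nonneg (mul_nonneg (Nat.cast_nonneg _) hd.le)]
      exact (hfin _).le
    · push_cast
      linear_combination (-(k : K)) * hab

theorem mem_inv_of_not_mball {W : Set K} {x : K} (hx : x ∈ W) (h : x ∉ mball W) : x⁻¹ ∈ W := by
  by_contra hc
  exact h ⟨hx, fun hh => hc hh.2.2⟩

theorem natProd_of_ordering {O₁ O₂ : Set K} (h : IsOrderingLocality O₂)
    (h₁ : Nice O₁) (h₂ : Nice O₂) {x : K} (hx₁ : x ∈ O₁)
    (hx : ∀ y ∈ O₂, x - y ∉ mball (joinSet O₁ O₂)) : NatProd O₁ O₂ := by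
  have hxj := subset_joinSet_left h₂ hx₁
  have h1 := subset_joinSet_left h₂ h₁.one_mem
  have hsub : ∀ a b : K, a ∈ joinSet O₁ O₂ → b ∈ joinSet O₁ O₂ → a - b ∈ joinSet O₁ O₂ :=
    fun a b ha hb => (joinRing h₁ h₂).sub_mem ha hb
  have hneg : ∀ a : K, a ∈ joinSet O₁ O₂ → -a ∈ joinSet O₁ O₂ :=
    fun a ha => (joinRing h₁ h₂).neg_mem _ ha
  refine natProd_of_ordering_aux h h₁ h₂ hx₁ ?_ ?_ ?_
  · intro hx₂
    refine hx x hx₂ ?_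
    rw [sub_self]
    exact ⟨(joinRing h₁ h₂).zero_mem, by simp⟩
  · exact mem_inv_of_not_mball (hsub _ _ hxj h1) (hx 1 h₂.one_mem)
  · have := mem_inv_of_not_mball (hsub _ _ hxj (hneg _ h1)) (hx (-1) (h₂.neg_mem _ h₂.one_mem))
    have e : (-x - 1)⁻¹ = -(x - -1)⁻¹ := by
      rw [← inv_neg]
      congr 1
      ring
    rw [e]
    exact hneg _ this

theorem mball_neg {O₁ O₂ : Set K} (h₁ : Nice O₁) (h₂ : Nice O₂) {x : K}
    (hx : x ∈ mball (joinSet O₁ O₂)) : -x ∈ mball (joinSet O₁ O₂) := by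
  have hneg : ∀ a : K, a ∈ joinSet O₁ O₂ → -a ∈ joinSet O₁ O₂ :=
    fun a ha => (joinRing h₁ h₂).neg_mem _ ha
  refine ⟨hneg _ hx.1, fun hh => hx.2 ⟨hx.1, ?_, ?_⟩⟩
  · simpa using hh.2.1
  · have := hneg _ hh.2.2
    simpa [inv_neg] using this

theorem natProd_of_strong {O₁ O₂ : Set K} (h₁ : IsLocality O₁) (h₂ : IsLocality O₂)
    (hs : StronglyIncomp O₁ O₂) : NatProd O₁ O₂ := by
  have n₁ := h₁.nice
  have n₂ := h₂.nice
  rcases h₁.cases with c | c | c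
  · exact natProd_of_valuation c n₂
  · rcases h₂.cases with d | d | d
    · exact (natProd_of_valuation d n₁).symm
    · have hr := hs.2 _ (joinSet_isFCC h₁ h₂ hs.1)
      rw [SameResidue, not_and_or] at hr
      push Not at hr
      rcases hr with ⟨x, hx, hx'⟩ | ⟨y, hy, hy'⟩
      · exact natProd_of_ordering d n₁ n₂ hx hx'
      · refine (natProd_of_ordering c n₂ n₁ hy fun x hx hm => hy' x hx ?_).symm
        rw [joinSet_comm] at hm
        simpa using mball_neg n₁ n₂ hm
    · exact (natProd_of_arch d n₂ n₁ hs.1.symm).symm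
  · exact natProd_of_arch c n₁ n₂ hs.1

theorem main_strong {v₁ v₂ : Set K} (h₁ : IsLocality v₁) (h₂ : IsLocality v₂)
    {z₁ z₂ : K} (hz₁ : z₁ ≠ 0) (hz₂ : z₂ ≠ 0)
    (hW : ∀ W : Set K, IsFCC v₁ v₂ W → scale z₁ W = scale z₂ W) (hs : StronglyIncomp v₁ v₂) :
    ∃ z : K, z ≠ 0 ∧ z ∈ scale z₁ (mball v₁) ∧ z⁻¹ ∈ scale z₂⁻¹ (mball v₂) := by
  have n₁ := h₁.nice
  have n₂ := h₂.nice
  have hsc := hW _ (joinSet_isFCC h₁ h₂ hs.1)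
  have hz : z₂ ∈ scale z₁ (joinSet v₁ v₂) := by
    rw [hsc]
    exact ⟨1, subset_joinSet_left n₂ n₁.one_mem, by simp⟩
  obtain ⟨u, ⟨N, a, ha, b, hb, rfl⟩, hu⟩ := hz
  obtain ⟨a', ha', b', hb', e⟩ := natProd_of_strong h₁ h₂ hs N
  obtain ⟨c, hc0, hc₁, hc₁', hc₂, hc₂'⟩ := exists_sep n₁ n₂ hs.1
  rw [e] at hu
  have ha0 : a' * a ≠ 0 := by
    intro h
    apply hz₂
    rw [hu]
    linear_combination z₁ * b' * b * h
  have hb0 : b' * b ≠ 0 := by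
    intro h
    apply hz₂
    rw [hu]
    linear_combination z₁ * a' * a * h
  have A := n₁.mul_mball (n₁.mul_mem _ ha' _ ha) ha0 hc₁ hc₁'
  have B := n₂.mul_mball (n₂.mul_mem _ hb' _ hb) hb0 hc₂ (by rwa [inv_inv])
  refine ⟨z₁ * (a' * a * c), by simp only [ne_eq, mul_eq_zero]; simp [hz₁, hc0]; simpa using ha0,
    ⟨_, ⟨A.1, fun h => A.2 h.2.2⟩, rfl⟩, ⟨_, ⟨B.1, fun h => B.2 h.2.2⟩, ?_⟩⟩
  have e2 : z₂ = z₁ * (a' * a) * (b' * b) := by rw [hu]; ring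
  rw [e2]
  generalize a' * a = p at *
  generalize b' * b = q at *
  field_simp

/-- **Proposition 2.4** (variant of Ribenboim's theorem for two localities).
If `z₁·O_w = z₂·O_w` for the finest common coarsening `w = v₁ ∨ v₂`, then:
(1) if `v₁, v₂` are strongly incomparable there is `z ∈ K^×` with `z ∈ z₁·m_{v₁}` and
`z⁻¹ ∈ z₂⁻¹·m_{v₂}`; (2) if they are comparable or strongly incomparable there is `z ∈ K^×`
with `z ∈ z₁·O_{v₁}` and `z⁻¹ ∈ z₂⁻¹·O_{v₂}`. -/
theorem ribenboim_two_localities {K : Type*} [Field K] (v₁ v₂ : Set K)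
    (h₁ : IsLocality v₁) (h₂ : IsLocality v₂)
    (z₁ z₂ : K) (hz₁ : z₁ ≠ 0) (hz₂ : z₂ ≠ 0)
    (hW : ∀ W : Set K, IsFCC v₁ v₂ W → scale z₁ W = scale z₂ W) :
    (StronglyIncomp v₁ v₂ →
      ∃ z : K, z ≠ 0 ∧ z ∈ scale z₁ (mball v₁) ∧ z⁻¹ ∈ scale z₂⁻¹ (mball v₂)) ∧
    ((v₁ ⊆ v₂ ∨ v₂ ⊆ v₁ ∨ StronglyIncomp v₁ v₂) →
      ∃ z : K, z ≠ 0 ∧ z ∈ scale z₁ v₁ ∧ z⁻¹ ∈ scale z₂⁻¹ v₂) := by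
  have n₁ := h₁.nice
  have n₂ := h₂.nice
  refine ⟨main_strong h₁ h₂ hz₁ hz₂ hW, ?_⟩
  rintro (h | h | h)
  · have hsc := hW v₂ ⟨h₂, h, subset_rfl, fun W' _ _ h => h⟩
    have hm : z₂ ∈ scale z₁ v₂ := by
      rw [hsc]
      exact ⟨1, n₂.one_mem, by simp⟩
    obtain ⟨s, hs, rfl⟩ := hm
    refine ⟨z₁, hz₁, ⟨1, n₁.one_mem, by simp⟩, s, hs, ?_⟩
    have : s ≠ 0 := right_ne_zero_of_mul hz₂
    field_simp
  · have hsc := hW v₁ ⟨h₁, subset_rfl, h, fun W' _ h _ => h⟩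
    have hm : z₂ ∈ scale z₁ v₁ := by
      rw [hsc]
      exact ⟨1, n₁.one_mem, by simp⟩
    exact ⟨z₂, hz₂, hm, 1, n₂.one_mem, by simp⟩
  · obtain ⟨z, hz, ⟨a, ha, ea⟩, b, hb, eb⟩ := main_strong h₁ h₂ hz₁ hz₂ hW h
    exact ⟨z, hz, ⟨a, ha.1, ea⟩, b, hb.1, eb⟩

end PaperApprox
end

section
/- Let K be a field, t ∈ K^×, and let f ∈ K[X] be a polynomial of degree d ≥ 2 with leading coefficient a_d. Then there exists a function φ : K^× × K^× → K^× (namely φ(x, y) = f(x·y^{−1})·y^d·t^{−1}) such that for every locality v on K satisfying conditions (i), (ii), (iii) below, and for all x, y ∈ K^×: (1) if x ∈ t·O_v and y ∈ t·O_v, then φ(x, y) ∈ x·O_v ∪ y·O_v; (2) if x^{−1} ∈ O_v or y^{−1} ∈ O_v, then φ(x, y)^{−1} ∈ x^{−1}·O_v ∩ y^{−1}·O_v. The conditions on v are: (i) f(x) ∈ O_v for all x ∈ O_v; (ii) f(x) ∉ t·m_v for all x ∈ O_v; (iii) f(x) ∈ x^d·(O_v \ t·m_v) ∩ (a_d·x^d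 + x^{d−1}·O_v) for all x ∉ O_v. -/
namespace PaperApprox

variable {K : Type*} [Field K]

/-- The elementary properties of a locality used in the proof. -/
theorem IsLocality.basic {O : Set K} (h : IsLocality O) :
    (0 : K) ∈ O ∧ (1 : K) ∈ O ∧ (∀ a ∈ O, ∀ b ∈ O, a * b ∈ O) ∧ ∀ a : K, a ∈ O ∨ a⁻¹ ∈ O := by
  rcases h with ⟨A, rfl⟩ | ⟨P, ⟨hadd, hmul, htot, hanti⟩, rfl⟩ | ⟨g, rfl⟩
  · exact ⟨A.zero_mem, A.one_mem, fun a ha b hb => A.mul_mem a b ha hb, A.mem_or_inv_mem⟩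
  · have hsq : ∀ a : K, a ^ 2 ∈ P := by
      intro a
      rcases htot a with h | h
      · simpa [sq] using hmul a h a h
      · simpa [sq] using hmul _ h _ h
    have h1 : (1 : K) ∈ P := by simpa using hsq 1
    have h0 : (0 : K) ∈ P := by simpa using hsq 0
    have h2 : (1 + 1 : K) ∈ P := hadd _ h1 _ h1
    have key : ∀ a : K, a ∈ orderingBall P ↔ 1 - a ^ 2 ∈ P := by
      intro a
      constructor
      · rintro ⟨ha, hb⟩
        have := hmul _ ha _ hb
        rwa [show (a + 1) * (1 - a) = 1 - a ^ 2 by ring] at this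
      · have half : ∀ a : K, 1 - a ^ 2 ∈ P → a + 1 ∈ P := by
          intro a ha
          rcases htot (a + 1) with h | h
          · exact h
          · have h3 : 1 - a ∈ P := by
              have := hadd _ h _ h2
              rwa [show -(a + 1) + (1 + 1) = 1 - a by ring] at this
            have h4 := hmul _ h3 _ h
            have h5 := hanti _ ha (by
              rwa [show (1 - a) * -(a + 1) = -(1 - a ^ 2) by ring] at h4)
            have h6 : (a + 1) * (1 - a) = 0 := by linear_combination h5
            rcases mul_eq_zero.1 h6 with h7 | h7
            · rw [h7]; exact h0
            · have : a = 1 := by linear_combination -h7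
              rw [this]; exact h2
        intro ha
        refine ⟨half a ha, ?_⟩
        have := half (-a) (by simpa using ha)
        rwa [show -a + 1 = 1 - a by ring] at this
    refine ⟨?_, ?_, ?_, ?_⟩
    · rw [key]; simpa using h1
    · rw [key]; simpa using h0
    · intro a ha b hb
      rw [key] at *
      have := hadd _ ha _ (hmul _ (hsq a) _ hb)
      rwa [show 1 - a ^ 2 + a ^ 2 * (1 - b ^ 2) = 1 - (a * b) ^ 2 by ring] at this
    · intro a
      rw [key, key]
      rcases htot (1 - a ^ 2) with h | h
      · exact Or.inl h
      · by_cases ha : a = 0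
        · left; simpa [ha] using h1
        · right
          have := hmul _ (hsq a⁻¹) _ h
          rwa [show a⁻¹ ^ 2 * -(1 - a ^ 2) = 1 - a⁻¹ ^ 2 by field_simp; ring] at this
  · refine ⟨by simp, by simp, ?_, ?_⟩
    · intro a ha b hb
      simp only [Set.mem_setOf_eq, map_mul] at *
      exact mul_le_one₀ ha (g.nonneg b) hb
    · intro a
      simp only [Set.mem_setOf_eq, map_inv₀]
      rcases le_total (g a) 1 with h | h
      · exact Or.inl h
      · exact Or.inr (inv_le_one_of_one_le₀ h)

theorem mem_scale_iff {z y : K} (hz : z ≠ 0) {S : Set K} : y ∈ scale z S ↔ y * z⁻¹ ∈ S := by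
  constructor
  · rintro ⟨s, hs, rfl⟩
    rwa [show z * s * z⁻¹ = s by field_simp]
  · intro h
    exact ⟨_, h, by field_simp⟩

theorem not_mem_scale_mball {O : Set K} (h : IsLocality O) {t s : K} (ht : t ≠ 0)
    (hs : s ∉ scale t (mball O)) : s ≠ 0 ∧ t * s⁻¹ ∈ O := by
  obtain ⟨h0, h1, hm, hi⟩ := h.basic
  rw [mem_scale_iff ht] at hs
  have hs0 : s ≠ 0 := by
    rintro rfl
    apply hs
    refine ⟨by simpa using h0, ?_⟩
    rintro ⟨-, h, -⟩
    simp at h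
  refine ⟨hs0, ?_⟩
  have e : (s * t⁻¹)⁻¹ = t * s⁻¹ := by field_simp
  rcases hi (s * t⁻¹) with h | h
  · by_contra hc
    apply hs
    refine ⟨h, ?_⟩
    rintro ⟨-, -, h'⟩
    rw [e] at h'
    exact hc h'
  · rwa [e] at h

theorem pow_mem_loc {O : Set K} (h : IsLocality O) {a : K} (ha : a ∈ O) (n : ℕ) : a ^ n ∈ O := by
  obtain ⟨h0, h1, hm, hi⟩ := h.basic
  induction n with
  | zero => simpa using h1
  | succ n ih => rw [pow_succ]; exact hm _ ih _ ha

/-- The common core: an element `s * y ^ d / t` with `t ≤ s ≤ 1`, where `y` is the larger one. -/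
theorem core {O : Set K} (h : IsLocality O) {t s x y : K} (ht : t ≠ 0) (htO : t ∈ O) (n : ℕ)
    (hx : x ≠ 0) (hy : y ≠ 0) (hsO : s ∈ O) (hs : s ≠ 0) (hts : t * s⁻¹ ∈ O)
    (hxy : x * y⁻¹ ∈ O) :
    s * y ^ (n + 2) * t⁻¹ ≠ 0 ∧
    (y ∈ scale t O → s * y ^ (n + 2) * t⁻¹ ∈ scale y O) ∧
    ((x⁻¹ ∈ O ∨ y⁻¹ ∈ O) → (s * y ^ (n + 2) * t⁻¹)⁻¹ ∈ scale x⁻¹ O ∩ scale y⁻¹ O) := by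
  obtain ⟨h0, h1, hm, hi⟩ := h.basic
  refine ⟨mul_ne_zero (mul_ne_zero hs (pow_ne_zero _ hy)) (inv_ne_zero ht), ?_, ?_⟩
  · intro hyt
    rw [mem_scale_iff ht] at hyt
    rw [mem_scale_iff hy]
    have hyO : y ∈ O := by
      have := hm _ hyt _ htO
      rwa [show y * t⁻¹ * t = y by field_simp] at this
    have := hm _ (hm _ hsO _ (pow_mem_loc h hyO n)) _ hyt
    rwa [show s * y ^ n * (y * t⁻¹) = s * y ^ (n + 2) * t⁻¹ * y⁻¹ by
      field_simp; ring] at this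
  · intro hxy'
    have hyi : y⁻¹ ∈ O := by
      rcases hxy' with h' | h'
      · have := hm _ h' _ hxy
        rwa [show x⁻¹ * (x * y⁻¹) = y⁻¹ by field_simp] at this
      · exact h'
    have hA : t * s⁻¹ * y⁻¹ ^ (n + 1) ∈ O := hm _ hts _ (pow_mem_loc h hyi _)
    constructor
    · rw [mem_scale_iff (inv_ne_zero hx)]
      have := hm _ hA _ hxy
      rwa [show t * s⁻¹ * y⁻¹ ^ (n + 1) * (x * y⁻¹) = (s * y ^ (n + 2) * t⁻¹)⁻¹ * x⁻¹⁻¹ by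
        rw [inv_pow]; field_simp; ring] at this
    · rw [mem_scale_iff (inv_ne_zero hy)]
      rwa [show t * s⁻¹ * y⁻¹ ^ (n + 1) = (s * y ^ (n + 2) * t⁻¹)⁻¹ * y⁻¹⁻¹ by
        rw [inv_pow]; field_simp; ring] at hA

/-- **Proposition 3.8**: the function `φ(x,y) = f(x·y⁻¹)·y^d·t⁻¹` and its min/max-like
properties for every locality satisfying conditions (i), (ii), (iii). -/
theorem exists_phi {K : Type*} [Field K] (t : K) (ht : t ≠ 0)
    (f : Polynomial K) (hd : 2 ≤ f.natDegree) :
    ∃ φ : K → K → K,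
      (∀ x y : K, x ≠ 0 → y ≠ 0 → φ x y = f.eval (x * y⁻¹) * y ^ f.natDegree * t⁻¹) ∧
      ∀ O : Set K, IsLocality O → CondI f O → CondII t f O → CondIII t f O →
        ∀ x y : K, x ≠ 0 → y ≠ 0 →
          φ x y ≠ 0 ∧
          (x ∈ scale t O → y ∈ scale t O → φ x y ∈ scale x O ∪ scale y O) ∧
          ((x⁻¹ ∈ O ∨ y⁻¹ ∈ O) → (φ x y)⁻¹ ∈ scale x⁻¹ O ∩ scale y⁻¹ O) := by
  refine ⟨fun x y => f.eval (x * y⁻¹) * y ^ f.natDegree * t⁻¹, fun _ _ _ _ => rfl, ?_⟩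
  intro O hO hI hII hIII x y hx hy
  obtain ⟨h0, h1, hm, hi⟩ := hO.basic
  have htO : t ∈ O := by
    obtain ⟨hn, hq⟩ := not_mem_scale_mball hO ht (hII 0 h0)
    have := hm _ hq _ (hI 0 h0)
    rwa [inv_mul_cancel_right₀ hn] at this
  by_cases hz : x * y⁻¹ ∈ O
  · obtain ⟨hn, hq⟩ := not_mem_scale_mball hO ht (hII _ hz)
    obtain ⟨n, hnd⟩ := Nat.exists_eq_add_of_le' hd
    have := core hO ht htO n hx hy (hI _ hz) hn hq hz
    rw [← hnd] at this
    exact ⟨this.1, fun _ h => Or.inr (this.2.1 h), this.2.2⟩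
  · obtain ⟨⟨s, ⟨hsO, hst⟩, hs⟩, -⟩ := hIII _ hz
    obtain ⟨hn, hq⟩ := not_mem_scale_mball hO ht hst
    obtain ⟨n, hnd⟩ := Nat.exists_eq_add_of_le' hd
    have hyx : y * x⁻¹ ∈ O := by
      have := (hi (x * y⁻¹)).resolve_left hz
      rwa [show (x * y⁻¹)⁻¹ = y * x⁻¹ by field_simp] at this
    have := core hO ht htO n hy hx hsO hn hq hyx
    rw [← hnd] at this
    have e : f.eval (x * y⁻¹) * y ^ f.natDegree * t⁻¹ = s * x ^ f.natDegree * t⁻¹ := by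
      rw [hs, mul_pow, inv_pow]
      field_simp
    dsimp only
    rw [e]
    exact ⟨this.1, fun h _ => Or.inl (this.2.1 h), fun h => (this.2.2 h.symm).symm⟩

end PaperApprox
end

section
/- Let K be a field, t ∈ K^×, f ∈ K[X] a polynomial of degree d ≥ 2 with leading coefficient a_d, and suppose φ : K^× × K^× → K^× is a function such that for every locality v on K satisfying conditions (i), (ii), (iii) below and all x, y ∈ K^×: if x, y ∈ t·O_v then φ(x, y) ∈ x·O_v ∪ y·O_v, and if x^{−1} ∈ O_v or y^{−1} ∈ O_v then φ(x, y)^{−1} ∈ x^{−1}·O_v ∩ y^{−1}·O_v. Define iteratively Φ(x_1) = x_1 and Φ(x_1, …, x_n) = φ(x_1, Φ(x_2, …, x_n)) for n > 1. Then for every locality v satisfying conditions (i), (ii), (iii) and all x_1, …, x_n ∈ K^×: (1) if x_i ∈ t·O_v for all i, then Φ(x_1, …, x_n) ∈ x_1·O_v ∪ ⋯ ∪ x_n·O_v; (2) if x_i^{−1} ∈ O_v for some i, then Φ(x_1, …, x_n)^{−1} ∈ x_1^{−1}·O_v ∩ ⋯ ∩ x_n^{−1}·O_v. The conditions on v are: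 (i) f(x) ∈ O_v for all x ∈ O_v; (ii) f(x) ∉ t·m_v for all x ∈ O_v; (iii) f(x) ∈ x^d·(O_v \ t·m_v) ∩ (a_d·x^d + x^{d−1}·O_v) for all x ∉ O_v. -/
namespace PaperApprox

variable {K : Type*} [Field K]

theorem locality_basic {K : Type*} [Field K] (O : Set K) (hO : IsLocality O) :
    (1 : K) ∈ O ∧ (∀ a ∈ O, ∀ b ∈ O, a * b ∈ O) ∧ ∀ a : K, a ∈ O ∨ a⁻¹ ∈ O := by
  rcases hO with ⟨A, rfl⟩ | ⟨P, ⟨hadd, hmul, htot, hanti⟩, rfl⟩ | ⟨g, rfl⟩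
  · exact ⟨A.one_mem, fun a ha b hb => A.mul_mem _ _ ha hb, fun a => A.mem_or_inv_mem a⟩
  · have hsq : ∀ x : K, x * x ∈ P := by
      intro x
      rcases htot x with h | h
      · exact hmul _ h _ h
      · simpa using hmul _ h _ h
    have h0 : (0 : K) ∈ P := by simpa using hsq 0
    have h1 : (1 : K) ∈ P := by simpa using hsq 1
    have two_ne : (2 : K) ≠ 0 := by
      intro h
      have h' : (-1 : K) = 1 := by linear_combination -h
      exact one_ne_zero (hanti 1 h1 (by rw [h']; exact h1))
    have half : ∀ x : K, x + x ∈ P → x ∈ P := by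
      intro x hx
      rcases htot x with h | h
      · exact h
      · have h2 : x + x = 0 := hanti _ hx (by
          have := hadd _ h _ h
          rwa [← neg_add] at this)
        have h3 : 2 * x = 0 := by linear_combination h2
        rcases mul_eq_zero.1 h3 with h4 | h4
        · exact absurd h4 two_ne
        · rw [h4]; exact h0
    have hpos : ∀ a : K, a ∈ P → a ∈ orderingBall P ∨ a⁻¹ ∈ orderingBall P := by
      intro a ha
      rcases htot (1 - a) with h | h
      · exact Or.inl ⟨hadd _ ha _ h1, h⟩
      · by_cases ha0 : a = 0
        · subst ha0
          exact Or.inl ⟨by simpa using h1, by simpa using h1⟩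
        have hi : a⁻¹ ∈ P := by
          have := hmul _ ha _ (hsq a⁻¹)
          rwa [← mul_assoc, mul_inv_cancel₀ ha0, one_mul] at this
        refine Or.inr ⟨hadd _ hi _ h1, ?_⟩
        have := hmul _ h _ hi
        have e : -(1 - a) * a⁻¹ = 1 - a⁻¹ := by field_simp; ring
        rwa [e] at this
    have hneg : ∀ a : K, -a ∈ orderingBall P → a ∈ orderingBall P := by
      rintro a ⟨h, h'⟩
      refine ⟨?_, ?_⟩
      · have e : a + 1 = 1 - -a := by ring
        rw [e]; exact h'
      · have e : 1 - a = -a + 1 := by ring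
        rw [e]; exact h
    refine ⟨⟨hadd _ h1 _ h1, by simpa using h0⟩, ?_, ?_⟩
    · rintro a ⟨ha, ha'⟩ b ⟨hb, hb'⟩
      refine ⟨half _ ?_, half _ ?_⟩
      · have := hadd _ (hmul _ ha _ hb) _ (hmul _ ha' _ hb')
        have e : (a * b + 1) + (a * b + 1) = (a + 1) * (b + 1) + (1 - a) * (1 - b) := by ring
        rwa [e]
      · have := hadd _ (hmul _ ha _ hb') _ (hmul _ ha' _ hb)
        have e : (1 - a * b) + (1 - a * b) = (a + 1) * (1 - b) + (1 - a) * (b + 1) := by ring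
        rwa [e]
    · intro a
      rcases htot a with h | h
      · exact hpos a h
      · rcases hpos _ h with h | h
        · exact Or.inl (hneg _ h)
        · exact Or.inr (hneg _ (by rwa [← inv_neg]))
  · refine ⟨by simp, ?_, ?_⟩
    · intro a ha b hb
      simp only [Set.mem_setOf_eq, map_mul] at *
      exact mul_le_one₀ ha (g.nonneg b) hb
    · intro a
      simp only [Set.mem_setOf_eq, map_inv₀]
      rcases le_total (g a) 1 with h | h
      · exact Or.inl h
      · exact Or.inr (inv_le_one_of_one_le₀ h)

theorem iterPhi_ne_zero {K : Type*} [Field K] (φ : K → K → K)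
    (hφ0 : ∀ x y : K, x ≠ 0 → y ≠ 0 → φ x y ≠ 0) (l : List K) :
    ∀ x : K, x ≠ 0 → (∀ a ∈ l, a ≠ 0) → iterPhi φ x l ≠ 0 := by
  induction l with
  | nil => intro x hx _; exact hx
  | cons y l ih =>
    intro x hx hl
    exact hφ0 _ _ hx (ih y (hl y (by simp)) fun a ha => hl a (by simp [ha]))

/-- **Corollary 3.9**: iterating `φ` yields a simultaneous min/max-like element
`Φ(x₁, …, xₙ)` for every locality satisfying conditions (i), (ii), (iii). -/
theorem iterPhi_min_max {K : Type*} [Field K] (t : K) (ht : t ≠ 0)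
    (f : Polynomial K) (hd : 2 ≤ f.natDegree)
    (φ : K → K → K) (hφ0 : ∀ x y : K, x ≠ 0 → y ≠ 0 → φ x y ≠ 0)
    (hφ : ∀ O : Set K, IsLocality O → CondI f O → CondII t f O → CondIII t f O →
      ∀ x y : K, x ≠ 0 → y ≠ 0 →
        (x ∈ scale t O → y ∈ scale t O → φ x y ∈ scale x O ∪ scale y O) ∧
        ((x⁻¹ ∈ O ∨ y⁻¹ ∈ O) → (φ x y)⁻¹ ∈ scale x⁻¹ O ∩ scale y⁻¹ O))
    (O : Set K) (hO : IsLocality O) (h1 : CondI f O) (h2 : CondII t f O) (h3 : CondIII t f O)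
    (x : K) (l : List K) (hx : x ≠ 0) (hl : ∀ a ∈ l, a ≠ 0) :
    ((∀ a ∈ x :: l, a ∈ scale t O) → ∃ a ∈ x :: l, iterPhi φ x l ∈ scale a O) ∧
    ((∃ a ∈ x :: l, a⁻¹ ∈ O) → ∀ a ∈ x :: l, (iterPhi φ x l)⁻¹ ∈ scale a⁻¹ O) := by
  obtain ⟨hone, hmul, htot⟩ := locality_basic O hO
  have strans : ∀ a b c : K, a ∈ scale b O → b ∈ scale c O → a ∈ scale c O := by
    rintro _ _ c ⟨s, hs, rfl⟩ ⟨r, hr, rfl⟩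
    exact ⟨r * s, hmul _ hr _ hs, by ring⟩
  have sO : ∀ a b : K, a ∈ scale b O → b ∈ O → a ∈ O := by
    rintro _ b ⟨s, hs, rfl⟩ hb
    exact hmul _ hb _ hs
  have srefl : ∀ a : K, a ∈ scale a O := fun a => ⟨1, hone, by ring⟩
  induction l generalizing x with
  | nil =>
    refine ⟨fun _ => ⟨x, by simp, srefl x⟩, fun _ a ha => ?_⟩
    obtain rfl : a = x := by simpa using ha
    exact srefl _
  | cons y l ih =>
    have hy : y ≠ 0 := hl y (by simp)
    have hl' : ∀ a ∈ l, a ≠ 0 := fun a ha => hl a (by simp [ha])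
    obtain ⟨ih1, ih2⟩ := ih y hy hl'
    have hz := iterPhi_ne_zero φ hφ0 l y hy hl'
    obtain ⟨p1, p2⟩ := hφ O hO h1 h2 h3 x _ hx hz
    constructor
    · intro h
      obtain ⟨a, ha, haz⟩ := ih1 fun a ha => h a (List.mem_cons_of_mem _ ha)
      rcases p1 (h x (by simp)) (strans _ _ _ haz (h a (List.mem_cons_of_mem _ ha))) with q | q
      · exact ⟨x, by simp, q⟩
      · exact ⟨a, List.mem_cons_of_mem _ ha, strans _ _ _ q haz⟩
    · intro h
      by_cases h' : ∃ a ∈ y :: l, a⁻¹ ∈ O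
      · have hi := ih2 h'
        obtain ⟨b, hb, hbO⟩ := h'
        obtain ⟨q1, q2⟩ := p2 (Or.inr (sO _ _ (hi b hb) hbO))
        intro a ha
        rcases List.mem_cons.1 ha with rfl | ha
        · exact q1
        · exact strans _ _ _ q2 (hi a ha)
      · have hxO : x⁻¹ ∈ O := by
          obtain ⟨b, hb, hbO⟩ := h
          rcases List.mem_cons.1 hb with rfl | hb
          · exact hbO
          · exact absurd ⟨b, hb, hbO⟩ h'
        obtain ⟨q1, -⟩ := p2 (Or.inl hxO)
        intro a ha
        rcases List.mem_cons.1 ha with rfl | ha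
        · exact q1
        · have haO : a ∈ O := (htot a).resolve_right fun hh => h' ⟨a, ha, hh⟩
          exact ⟨a * _, hmul _ haO _ (sO _ _ q1 hxO),
            (inv_mul_cancel_left₀ (hl a ha) _).symm⟩

end PaperApprox
end

section
/- Let K be a field, t ∈ K^×, and S a set of localities on K such that Assumption (U) holds for S and t, witnessed by a polynomial f of degree d ≥ 2 with leading coefficient a_d. Let v ∈ S, z ∈ K^× and b ∈ K^×. Then f(b^{−1}) ≠ 0, and the element x = a_d·b^{−d}·f(b^{−1})^{−1} satisfies: (1) x − 1 ∈ z·m_v if b ∈ t·m_v ∩ t·z·m_v, and (2) x ∈ z·m_v if b^{−1} ∈ t·m_v ∩ t·z·m_v; moreover the same two implications hold with m_v replaced by O_v throughout (in both hypotheses and conclusions). -/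
namespace PaperApprox

variable {K : Type*} [Field K]

theorem locality_facts (O : Set K) (h : IsLocality O) :
    (0 : K) ∈ O ∧ (1 : K) ∈ O ∧ (∀ x ∈ O, -x ∈ O) ∧ (∀ x ∈ O, ∀ y ∈ O, x * y ∈ O) ∧
      ∀ x : K, x ∈ O ∨ x⁻¹ ∈ O := by
  rcases h with ⟨A, rfl⟩ | ⟨P, ⟨hadd, hmul, htot, -⟩, rfl⟩ | ⟨g, rfl⟩
  · exact ⟨A.zero_mem, A.one_mem, fun x hx => A.neg_mem x hx, fun x hx y hy => A.mul_mem x y hx hy,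
      A.mem_or_inv_mem⟩
  · have hsq : ∀ x : K, x * x ∈ P := by
      intro x
      rcases htot x with hx | hx
      · exact hmul _ hx _ hx
      · have := hmul _ hx _ hx
        rwa [neg_mul_neg] at this
    have h1 : (1 : K) ∈ P := by simpa using hsq 1
    have h0 : (0 : K) ∈ P := by simpa using hsq 0
    have hhalf : ∀ q : K, q + q ∈ P → q ∈ P := by
      intro q hq
      rcases htot q with h | h
      · exact h
      · have := hadd _ hq _ h
        rwa [add_neg_cancel_right] at this
    have hneg : ∀ x ∈ orderingBall P, -x ∈ orderingBall P := by
      rintro x ⟨hx, hx'⟩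
      refine ⟨?_, ?_⟩
      · convert hx' using 1; ring
      · convert hx using 1; ring
    have hm : ∀ x ∈ orderingBall P, ∀ y ∈ orderingBall P, 1 - x * y ∈ P := by
      rintro x ⟨hx, hx'⟩ y ⟨hy, hy'⟩
      apply hhalf
      convert hadd _ (hmul _ hx' _ hy) _ (hmul _ hx _ hy') using 1
      ring
    have hbig : ∀ x : K, x - 1 ∈ P → x⁻¹ ∈ orderingBall P := by
      intro x hx
      have hxP : x ∈ P := by
        convert hadd _ hx _ h1 using 1; ring
      by_cases hx0 : x = 0
      · subst hx0
        rw [inv_zero]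
        exact ⟨by simpa using h1, by simpa using h1⟩
      have hi : x⁻¹ ∈ P := by
        convert hmul _ hxP _ (hsq x⁻¹) using 1; field_simp
      refine ⟨hadd _ hi _ h1, ?_⟩
      convert hmul _ hi _ hx using 1; field_simp
    refine ⟨⟨by simpa using h1, by simpa using h1⟩, ⟨hadd _ h1 _ h1, by simpa using h0⟩, hneg,
      ?_, ?_⟩
    · intro x hx y hy
      refine ⟨?_, hm x hx y hy⟩
      convert hm x hx _ (hneg y hy) using 1; ring
    · intro x
      by_cases h : x ∈ orderingBall P
      · exact Or.inl h
      right
      rcases htot (x + 1) with h2 | h2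
      · rcases htot (1 - x) with h3 | h3
        · exact absurd ⟨h2, h3⟩ h
        · apply hbig
          convert h3 using 1; ring
      · have h3 : (-x)⁻¹ ∈ orderingBall P := by
          apply hbig
          convert h2 using 1; ring
        have := hneg _ h3
        rwa [inv_neg, neg_neg] at this
  · simp only [Set.mem_ofPred_eq]
    refine ⟨by simp, by simp, fun x hx => by simpa using hx, fun x hx y hy => ?_, fun x => ?_⟩
    · rw [map_mul]
      exact mul_le_one₀ hx (g.nonneg y) hy
    · rcases le_total (g x) 1 with h | h
      · exact Or.inl h
      · right
        rw [map_inv₀]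
        exact inv_le_one_of_one_le₀ h

/-- **Lemma 4.3**: the element `x = a_d·b^{-d}·f(b⁻¹)⁻¹` approximates `1` resp. `0`
according to whether `b` is small resp. big, both in Situation `m` and in Situation `O`. -/
theorem approximation_lemma {K : Type*} [Field K] (t : K) (ht : t ≠ 0)
    (S : Set (Set K)) (hSloc : ∀ v ∈ S, IsLocality v)
    (f : Polynomial K) (hd : 2 ≤ f.natDegree)
    (hf : ∀ v ∈ S, CondI f v ∧ CondII t f v ∧ CondIII t f v ∧ CondIV t v)
    (v : Set K) (hv : v ∈ S) (z b : K) (hz : z ≠ 0) (hb : b ≠ 0) :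
    f.eval b⁻¹ ≠ 0 ∧
    (b ∈ scale t (mball v) ∩ scale (t * z) (mball v) →
      f.leadingCoeff * b⁻¹ ^ f.natDegree * (f.eval b⁻¹)⁻¹ - 1 ∈ scale z (mball v)) ∧
    (b⁻¹ ∈ scale t (mball v) ∩ scale (t * z) (mball v) →
      f.leadingCoeff * b⁻¹ ^ f.natDegree * (f.eval b⁻¹)⁻¹ ∈ scale z (mball v)) ∧
    (b ∈ scale t v ∩ scale (t * z) v →
      f.leadingCoeff * b⁻¹ ^ f.natDegree * (f.eval b⁻¹)⁻¹ - 1 ∈ scale z v) ∧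
    (b⁻¹ ∈ scale t v ∩ scale (t * z) v →
      f.leadingCoeff * b⁻¹ ^ f.natDegree * (f.eval b⁻¹)⁻¹ ∈ scale z v) := by
  obtain ⟨h0, h1, hneg, hmul, htot⟩ := locality_facts v (hSloc v hv)
  obtain ⟨hI, hII, hIII, hIV⟩ := hf v hv
  have hm0 : (0 : K) ∈ mball v := ⟨h0, fun h => h.2.1 rfl⟩
  have hmv : ∀ s ∈ mball v, s ∈ v := fun s hs => hs.1
  have hmm : ∀ s ∈ mball v, ∀ o ∈ v, s * o ∈ mball v := by
    intro s hs o ho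
    refine ⟨hmul _ hs.1 _ ho, fun h => hs.2 ⟨hs.1, ?_, ?_⟩⟩
    · exact left_ne_zero_of_mul h.2.1
    · have h2 := hmul _ ho _ h.2.2
      have hs0 : s ≠ 0 := left_ne_zero_of_mul h.2.1
      have ho0 : o ≠ 0 := right_ne_zero_of_mul h.2.1
      convert h2 using 1
      field_simp
  -- elements outside `t * m`
  have hout : ∀ w, w ∉ scale t (mball v) → w ≠ 0 ∧ t * w⁻¹ ∈ v := by
    intro w hw
    have hw0 : w ≠ 0 := by
      rintro rfl
      exact hw ⟨0, hm0, by simp⟩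
    refine ⟨hw0, ?_⟩
    by_contra hc
    apply hw
    refine ⟨t⁻¹ * w, ?_, by field_simp⟩
    have e : (t⁻¹ * w)⁻¹ = t * w⁻¹ := by field_simp
    refine ⟨?_, fun h => hc (e ▸ h.2.2)⟩
    rcases htot (t⁻¹ * w) with h | h
    · exact h
    · exact absurd (e ▸ h) hc
  have htv : t ∈ v := by
    obtain ⟨s, hs, e⟩ := hIV 1 h1 0 h0
    have : s = t := by
      field_simp at e
      simpa using e.symm
    exact this ▸ hs
  have hpow : ∀ c ∈ v, ∀ n : ℕ, c ^ n ∈ v := by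
    intro c hc n
    induction n with
    | zero => simpa using h1
    | succ n ih => rw [pow_succ]; exact hmul _ ih _ hc
  obtain ⟨n, hn⟩ : ∃ n, f.natDegree = n + 2 := ⟨f.natDegree - 2, by omega⟩
  have hnz : f.eval b⁻¹ ≠ 0 := by
    by_cases hc : b⁻¹ ∈ v
    · exact (hout _ (hII _ hc)).1
    · obtain ⟨⟨w, hw, e⟩, -⟩ := hIII _ hc
      rw [e]
      exact mul_ne_zero (pow_ne_zero _ (inv_ne_zero hb)) (hout w hw.2).1
  -- `t * a_d` is integral, unless `v` is everything
  have hlead : (∃ x, x ∉ v) → t * f.leadingCoeff ∈ v := by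
    rintro ⟨x, hx⟩
    have hx0 : x ≠ 0 := fun h => hx (h ▸ h0)
    have hxi : x⁻¹ ∈ v := (htot x).resolve_left hx
    obtain ⟨⟨w, hw, e⟩, u, hu, e2⟩ := hIII x hx
    obtain ⟨s, hs, e3⟩ := hIV w hw.1 _ (hneg _ (hmul _ hxi _ hu))
    have e4 : f.leadingCoeff = w + -(x⁻¹ * u) := by
      rw [e, hn, show n + 2 - 1 = n + 1 from rfl] at e2
      have hp : x ^ (n + 2) ≠ 0 := pow_ne_zero _ hx0
      apply mul_left_cancel₀ hp
      have : x ^ (n + 2) * (w + -(x⁻¹ * u)) = x ^ (n + 2) * w - x ^ (n + 1) * u := by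
        field_simp
        ring
      rw [this, e2]; ring
    rw [e4, e3, mul_inv_cancel_left₀ ht]
    exact hs
  have key1 : ∀ Q : Set K, (∀ s ∈ Q, ∀ o ∈ v, s * o ∈ Q) → b⁻¹ ∉ v → b ∈ scale (t * z) Q →
      f.leadingCoeff * b⁻¹ ^ f.natDegree * (f.eval b⁻¹)⁻¹ - 1 ∈ scale z Q := by
    rintro Q hQ hc ⟨s, hs, e⟩
    obtain ⟨⟨w, hw, e1⟩, u, hu, e2⟩ := hIII _ hc
    obtain ⟨hw0, hw1⟩ := hout w hw.2
    refine ⟨s * (-(u * (t * w⁻¹))), hQ _ hs _ (hneg _ (hmul _ hu _ hw1)), ?_⟩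
    have e3 : f.leadingCoeff * b⁻¹ ^ f.natDegree = f.eval b⁻¹ - b⁻¹ ^ (f.natDegree - 1) * u := by
      rw [e2]; ring
    rw [e3, sub_mul, mul_inv_cancel₀ hnz, e1, hn, show n + 2 - 1 = n + 1 from rfl]
    have e4 : b⁻¹ ^ (n + 1) * u * (b⁻¹ ^ (n + 2) * w)⁻¹ = b * u * w⁻¹ := by
      rw [inv_pow, inv_pow]
      field_simp
      ring
    rw [e4]
    calc 1 - b * u * w⁻¹ - 1 = -(b * u * w⁻¹) := by ring
      _ = -((t * z * s) * u * w⁻¹) := by rw [← e]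
      _ = _ := by ring
  have key2 : ∀ Q : Set K, (∀ s ∈ Q, ∀ o ∈ v, s * o ∈ Q) → t * f.leadingCoeff ∈ v →
      b⁻¹ ∈ scale t v → b⁻¹ ∈ scale (t * z) Q →
      f.leadingCoeff * b⁻¹ ^ f.natDegree * (f.eval b⁻¹)⁻¹ ∈ scale z Q := by
    rintro Q hQ ha ⟨r, hr, er⟩ ⟨s, hs, e⟩
    have hc : b⁻¹ ∈ v := er ▸ hmul _ htv _ hr
    obtain ⟨hw0, hw1⟩ := hout _ (hII _ hc)
    refine ⟨s * ((t * f.leadingCoeff * r) * b⁻¹ ^ n * (t * (f.eval b⁻¹)⁻¹)),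
      hQ _ hs _ (hmul _ (hmul _ (hmul _ ha _ hr) _ (hpow _ hc n)) _ hw1), ?_⟩
    rw [hn]
    calc f.leadingCoeff * b⁻¹ ^ (n + 2) * (f.eval b⁻¹)⁻¹
        = f.leadingCoeff * b⁻¹ ^ n * b⁻¹ * b⁻¹ * (f.eval b⁻¹)⁻¹ := by ring
      _ = f.leadingCoeff * b⁻¹ ^ n * (t * r) * (t * z * s) * (f.eval b⁻¹)⁻¹ := by
        rw [← er, ← e]
      _ = _ := by ring
  have hall : (∀ x, x ∈ v) → ∀ y, y ∈ scale z v := fun h y =>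
    ⟨z⁻¹ * y, h _, by field_simp⟩
  refine ⟨hnz, ?_, ?_, ?_, ?_⟩
  · rintro ⟨⟨s, hs, e⟩, h⟩
    refine key1 _ hmm (fun hc => ?_) h
    have hbm : b ∈ mball v := by
      rw [e, mul_comm]; exact hmm _ hs _ htv
    exact hbm.2 ⟨hbm.1, hb, hc⟩
  · rintro ⟨⟨s, hs, e⟩, h⟩
    refine key2 _ hmm (hlead ⟨b, fun hc => ?_⟩) ⟨s, hs.1, e⟩ h
    have hbm : b⁻¹ ∈ mball v := by
      rw [e, mul_comm]; exact hmm _ hs _ htv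
    exact hbm.2 ⟨hbm.1, inv_ne_zero hb, by rwa [inv_inv]⟩
  · rintro ⟨⟨s, hs, e⟩, h⟩
    by_cases hc : b⁻¹ ∈ v
    · by_cases hv' : ∀ x, x ∈ v
      · exact hall hv' _
      push Not at hv'
      have hti : t⁻¹ ∈ v := by
        have hs0 : s ≠ 0 := by
          rintro rfl
          exact hb (by simpa using e)
        have : t⁻¹ = s * b⁻¹ := by
          rw [e]; field_simp
        rw [this]; exact hmul _ hs _ hc
      have hzi : z⁻¹ ∈ v := by
        obtain ⟨r, hr, er⟩ := h
        have hr0 : r ≠ 0 := by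
          rintro rfl
          exact hb (by simpa using er)
        have : z⁻¹ = t * r * b⁻¹ := by
          rw [er]; field_simp
        rw [this]; exact hmul _ (hmul _ htv _ hr) _ hc
      have hx : f.leadingCoeff * b⁻¹ ^ f.natDegree * (f.eval b⁻¹)⁻¹ ∈ v := by
        have := hmul _ (hmul _ (hmul _ hti _ (hlead hv')) _ (hpow _ hc f.natDegree)) _
          (hmul _ hti _ (hout _ (hII _ hc)).2)
        rwa [inv_mul_cancel_left₀ ht, inv_mul_cancel_left₀ ht] at this
      obtain ⟨r, hr, er⟩ := hIV _ hx _ (hneg _ h1)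
      refine ⟨z⁻¹ * (t⁻¹ * r), hmul _ hzi _ (hmul _ hti _ hr), ?_⟩
      rw [mul_inv_cancel_left₀ hz, ← er, sub_eq_add_neg]
    · exact key1 _ hmul hc h
  · rintro ⟨h, h'⟩
    by_cases hv' : ∀ x, x ∈ v
    · exact hall hv' _
    push Not at hv'
    exact key2 _ hmul (hlead hv') h h'

end PaperApprox
end
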